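/- arXiv:0711.1229 — 2 statements merged into one kernel-verified Lean document; each statement's English description precedes it below -/
import Mathlib

section
/- Let S ⊆ S² be a fine set and let ε₀ > 0 be such that the closed geodesic balls of radius ε₀ centered at the points of S ∪ (−S) are pairwise disjoint and every open geodesic ball of radius π/2 − ε₀ contains at least 3 points of S. Then for every p ∈ S² and every unit tangent vector u at p there exist ε₁ ∈ (0, ε₀) and η > 0 such that: for every q ∈ S² and every unit tangent vector w at q with ‖q − p‖ < η and ‖w − u‖ < η, and for every ε ∈ (0, ε₁), there exists a unit tangent vector x at q with ⟨w,x⟩ > 0 and ∫₀^π f^ε_S(γ_{q,x}(t)) dt < 0. -/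
open scoped RealInnerProductSpace
open Real

noncomputable section

/-- Euclidean 3-space. -/
abbrev E3 : Type := EuclideanSpace ℝ (Fin 3)

/-- The unit sphere S² in ℝ³. -/
def sphere2 : Set E3 := {x : E3 | ‖x‖ = 1}

/-- The round (geodesic) distance ρ(p,q) = arccos⟨p,q⟩ on S². -/
def rho (p q : E3) : ℝ := Real.arccos ⟪p, q⟫

/-- `UnitTangent p v` : `v` is a unit tangent vector at `p`. -/
def UnitTangent (p v : E3) : Prop := ‖v‖ = 1 ∧ ⟪p, v⟫ = 0

/-- The unit-speed great-circle arc γ_{p,v}(t) = (cos t)·p + (sin t)·v. -/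
def geo (p v : E3) (t : ℝ) : E3 := (Real.cos t) • p + (Real.sin t) • v
open Pointwise

/-- A great circle: the intersection of S² with a two-dimensional linear
subspace of ℝ³. -/
def GreatCircle (C : Set E3) : Prop :=
  ∃ P : Submodule ℝ E3, Module.finrank ℝ P = 2 ∧ C = sphere2 ∩ (P : Set E3)

/-- A finite subset `S` of the sphere is *fine* if (1) no three distinct points
of `S` lie on a common great circle, (2) whenever three pairwise distinct great
circles, each through two distinct points of `S`, share a common point `x` of
the sphere, then `x ∈ S ∪ (-S)`, and (3) every open hemisphere contains at
least 3 points of `S`. -/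
def Fine (S : Set E3) : Prop :=
  S.Finite ∧ S ⊆ sphere2 ∧
  (∀ x ∈ S, ∀ y ∈ S, ∀ z ∈ S, x ≠ y → y ≠ z → x ≠ z →
    ∀ C : Set E3, GreatCircle C → x ∈ C → y ∈ C → z ∈ C → False) ∧
  (∀ C₁ C₂ C₃ : Set E3, GreatCircle C₁ → GreatCircle C₂ → GreatCircle C₃ →
    C₁ ≠ C₂ → C₂ ≠ C₃ → C₁ ≠ C₃ →
    (∃ a ∈ S, ∃ b ∈ S, a ≠ b ∧ a ∈ C₁ ∧ b ∈ C₁) →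
    (∃ a ∈ S, ∃ b ∈ S, a ≠ b ∧ a ∈ C₂ ∧ b ∈ C₂) →
    (∃ a ∈ S, ∃ b ∈ S, a ≠ b ∧ a ∈ C₃ ∧ b ∈ C₃) →
    ∀ x ∈ sphere2, x ∈ C₁ → x ∈ C₂ → x ∈ C₃ → x ∈ S ∪ (-S)) ∧
  (∀ n ∈ sphere2, 3 ≤ {x ∈ S | 0 < ⟪x, n⟫}.ncard)
/-- The bump function `δ^ε_p`, supported in the geodesic ball `B(p,ε)`:
`δ^ε_p(q) = exp(1/ε)·exp(1/(ρ(p,q) − ε))` for `ρ(p,q) < ε`, and `0` otherwise. -/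
def deltaFn (p : E3) (ε : ℝ) (q : E3) : ℝ :=
  if rho p q < ε then Real.exp (1 / ε) * Real.exp (1 / (rho p q - ε)) else 0
/-- `f^ε_S = Σ_{p ∈ S} (δ^ε_{−p} − δ^ε_p)`. -/
def fS (S : Set E3) (ε : ℝ) (q : E3) : ℝ :=
  ∑ᶠ p ∈ S, (deltaFn (-p) ε q - deltaFn p ε q)

/-- The radial profile of `deltaFn`, as a function of the inner product. -/
def bump (ε c : ℝ) : ℝ :=
  if arccos c < ε then exp (1 / ε) * exp (1 / (arccos c - ε)) else 0

lemma bump_nonneg (ε c : ℝ) : 0 ≤ bump ε c := by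
  unfold bump
  split_ifs <;> positivity

lemma bump_monotone (ε : ℝ) : Monotone (bump ε) := by
  intro c d hcd
  have h := Real.antitone_arccos hcd
  by_cases hc : arccos c < ε
  · have hd : arccos d < ε := h.trans_lt hc
    simp only [bump, hc, hd, if_true]
    gcongr exp _ * exp ?_
    exact one_div_le_one_div_of_neg_of_le (by linarith) (by linarith)
  · simpa only [bump, hc, if_false] using bump_nonneg ε d

lemma bump_lt_bump {ε c d : ℝ} (hc : -1 ≤ c) (hcd : c < d) (hd : d ≤ 1)
    (h : arccos d < ε) : bump ε c < bump ε d := by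
  have hlt := Real.strictAntiOn_arccos ⟨hc, hcd.le.trans hd⟩ ⟨hc.trans hcd.le, hd⟩ hcd
  by_cases hc' : arccos c < ε
  · simp only [bump, hc', h, if_true]
    gcongr exp _ * exp ?_
    exact one_div_lt_one_div_of_neg_of_lt (by linarith) (by linarith)
  · simp only [bump, hc', h, if_true, if_false]
    positivity

lemma bump_eq_zero {ε c : ℝ} (h0 : 0 ≤ ε) (hπ : ε ≤ π) (h : c ≤ cos ε) : bump ε c = 0 := by
  have : ε ≤ arccos c := by
    simpa only [Real.arccos_cos h0 hπ] using Real.antitone_arccos h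
  simp [bump, this.not_gt]

lemma intervalIntegrable_bump_comp (ε : ℝ) {g : ℝ → ℝ} (hg : Continuous g) (a b : ℝ) :
    IntervalIntegrable (fun t => bump ε (g t)) MeasureTheory.volume a b := by
  refine (intervalIntegrable_const (c := bump ε 1)).mono_fun
    ((bump_monotone ε).measurable.comp hg.measurable).aestronglyMeasurable ?_
  refine Filter.Eventually.of_forall fun t => ?_
  have hle : bump ε (g t) ≤ bump ε 1 := by
    rcases le_total (g t) 1 with h | h
    · exact bump_monotone ε h
    · simp [bump, Real.arccos_of_one_le h]
  simpa [abs_of_nonneg (bump_nonneg ε _)] using hle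

/-- The contribution of a pair `±s` to the integral along a half great circle, where
`a` and `b` are the inner products of `s` with the base point and the direction. -/
def pairIntegral (ε a b : ℝ) : ℝ :=
  ∫ t in (0 : ℝ)..π, (bump ε (-(a * cos t + b * sin t)) - bump ε (a * cos t + b * sin t))

lemma intervalIntegrable_pair (ε a b : ℝ) :
    IntervalIntegrable (fun t => bump ε (-(a * cos t + b * sin t)) -
      bump ε (a * cos t + b * sin t)) MeasureTheory.volume 0 π :=
  (intervalIntegrable_bump_comp ε (by fun_prop) _ _).sub
    (intervalIntegrable_bump_comp ε (by fun_prop) _ _)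

lemma pairIntegral_nonpos (ε a : ℝ) {b : ℝ} (hb : 0 ≤ b) : pairIntegral ε a b ≤ 0 := by
  set g : ℝ → ℝ := fun t => bump ε (-(a * cos t + b * sin t)) - bump ε (a * cos t + b * sin t)
    with hg
  have hint : IntervalIntegrable g MeasureTheory.volume 0 π := intervalIntegrable_pair ε a b
  have hint' : IntervalIntegrable (fun t => g (π - t)) MeasureTheory.volume 0 π := by
    simpa using (hint.comp_sub_left π).symm
  have hrefl : ∫ t in (0 : ℝ)..π, g (π - t) = ∫ t in (0 : ℝ)..π, g t := by
    simp
  have hsum : ∫ t in (0 : ℝ)..π, (g t + g (π - t)) ≤ 0 := by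
    have := intervalIntegral.integral_mono_on (f := fun t => g t + g (π - t))
      (g := fun _ => (0 : ℝ)) pi_pos.le (hint.add hint') intervalIntegrable_const ?_
    · simpa using this
    · intro t ht
      have hs : 0 ≤ b * sin t := mul_nonneg hb (sin_nonneg_of_mem_Icc ht)
      have h1 := bump_monotone ε
        (show -(a * cos t + b * sin t) ≤ -(a * cos t) + b * sin t by linarith)
      have h2 := bump_monotone ε
        (show a * cos t - b * sin t ≤ a * cos t + b * sin t by linarith)
      simp only [hg, cos_pi_sub, sin_pi_sub]
      have e1 : -(a * -cos t + b * sin t) = a * cos t - b * sin t := by ring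
      have e2 : a * -cos t + b * sin t = -(a * cos t) + b * sin t := by ring
      rw [e1, e2]
      linarith
  rw [intervalIntegral.integral_add hint hint', hrefl] at hsum
  change ∫ t in (0 : ℝ)..π, g t ≤ 0
  linarith

lemma exists_polar (a b : ℝ) :
    ∃ φ : ℝ, ∀ t, a * cos t + b * sin t = √(a ^ 2 + b ^ 2) * cos (t - φ) := by
  refine ⟨Complex.arg ⟨a, b⟩, fun t => ?_⟩
  have hre := Complex.norm_mul_cos_arg ⟨a, b⟩
  have him := Complex.norm_mul_sin_arg ⟨a, b⟩
  have hn : ‖(⟨a, b⟩ : ℂ)‖ = √(a ^ 2 + b ^ 2) := by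
    rw [Complex.norm_def, Complex.normSq_mk]; ring_nf
  rw [hn] at hre him
  simp only at hre him
  rw [cos_sub]
  linear_combination (-cos t) * hre - sin t * him

lemma abs_mul_cos_add_mul_sin_le (a b t : ℝ) :
    |a * cos t + b * sin t| ≤ √(a ^ 2 + b ^ 2) := by
  obtain ⟨φ, h⟩ := exists_polar a b
  rw [h, abs_mul, abs_of_nonneg (sqrt_nonneg _)]
  exact mul_le_of_le_one_right (sqrt_nonneg _) (abs_cos_le_one _)

lemma pairIntegral_eq_zero {ε a b : ℝ} (h0 : 0 ≤ ε) (hε : ε ≤ π / 2)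
    (h : a ^ 2 + b ^ 2 ≤ cos ε ^ 2) : pairIntegral ε a b = 0 := by
  have hcos : 0 ≤ cos ε := cos_nonneg_of_neg_pi_div_two_le_of_le (by linarith [pi_pos]) hε
  have hπ : ε ≤ π := by linarith [pi_pos]
  have hle : √(a ^ 2 + b ^ 2) ≤ cos ε := (sqrt_le_sqrt h).trans_eq (sqrt_sq hcos)
  have hz : ∀ t, bump ε (-(a * cos t + b * sin t)) - bump ε (a * cos t + b * sin t) = 0 := by
    intro t
    have := abs_le.1 ((abs_mul_cos_add_mul_sin_le a b t).trans hle)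
    rw [bump_eq_zero h0 hπ this.2, bump_eq_zero h0 hπ (by linarith), sub_zero]
  simp only [pairIntegral, hz, intervalIntegral.integral_zero]

lemma integral_bump_mul_abs_cos_sub (ε R φ : ℝ) :
    ∫ t in (0 : ℝ)..π, bump ε (R * |cos (t - φ)|) = ∫ t in (0 : ℝ)..π, bump ε (R * |cos t|) := by
  have hper : Function.Periodic (fun t => bump ε (R * |cos t|)) π := fun t => by
    simp [cos_add_pi]
  rw [intervalIntegral.integral_comp_sub_right (fun t => bump ε (R * |cos t|))]
  have := hper.intervalIntegral_add_eq (0 - φ) 0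
  rw [zero_add] at this
  rw [← this]
  congr 1
  ring

lemma integral_bump_mul_abs_cos_lt {ε R : ℝ} (h0 : 0 < ε) (hε : ε < π / 2) (hR0 : 0 ≤ R)
    (hR : R < 1) :
    ∫ t in (0 : ℝ)..π, bump ε (R * |cos t|) < ∫ t in (0 : ℝ)..π, bump ε |cos t| := by
  refine intervalIntegral.integral_lt_integral_of_ae_le_of_measure_setOfPred_lt_ne_zero
    pi_pos.le
    (intervalIntegrable_bump_comp ε (by fun_prop) _ _)
    (intervalIntegrable_bump_comp ε (by fun_prop) _ _)
    (Filter.Eventually.of_forall fun t =>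
      bump_monotone ε (mul_le_of_le_one_left (abs_nonneg _) hR.le)) ?_
  have hsub : Set.Ioo 0 ε ⊆ {t | bump ε (R * |cos t|) < bump ε |cos t|} := by
    intro t ht
    have hc : 0 < cos t := cos_pos_of_mem_Ioo ⟨by linarith [ht.1, pi_pos], by linarith [ht.2]⟩
    simp only [Set.mem_ofPred_eq, abs_of_pos hc]
    refine bump_lt_bump ?_ (mul_lt_of_lt_one_left hc hR) (cos_le_one t) ?_
    · linarith [mul_nonneg hR0 hc.le]
    · rw [arccos_cos ht.1.le (by linarith [ht.2, pi_pos])]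
      exact ht.2
  have hsub' : Set.Ioo 0 ε ⊆ Set.Ioc 0 π := fun t ht => ⟨ht.1, by linarith [ht.2, pi_pos]⟩
  intro hzero
  have h1 := MeasureTheory.measure_mono_null hsub hzero
  rw [MeasureTheory.Measure.restrict_apply measurableSet_Ioo,
    Set.inter_eq_left.2 hsub', Real.volume_Ioo] at h1
  simp at h1
  linarith

lemma pairIntegral_lt {ε a b : ℝ} (h0 : 0 < ε) (hε : ε < π / 2) (h : a ^ 2 + b ^ 2 < 1) :
    pairIntegral ε a b < ∫ t in (0 : ℝ)..π, bump ε |cos t| := by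
  obtain ⟨φ, hφ⟩ := exists_polar a b
  have hR : √(a ^ 2 + b ^ 2) < 1 := by
    rw [Real.sqrt_lt' one_pos]; simpa using h
  refine lt_of_le_of_lt ?_ (integral_bump_mul_abs_cos_lt h0 hε (sqrt_nonneg _) hR)
  rw [← integral_bump_mul_abs_cos_sub ε _ φ]
  refine intervalIntegral.integral_mono_on pi_pos.le (intervalIntegrable_pair ε a b)
    (intervalIntegrable_bump_comp ε (by fun_prop) _ _) fun t _ => ?_
  have hle : bump ε (-(a * cos t + b * sin t)) ≤ bump ε (√(a ^ 2 + b ^ 2) * |cos (t - φ)|) := by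
    apply bump_monotone
    rw [hφ, ← mul_neg]
    exact mul_le_mul_of_nonneg_left (neg_le_abs _) (sqrt_nonneg _)
  linarith [bump_nonneg ε (a * cos t + b * sin t)]

lemma pairIntegral_cos_sin {ε θ : ℝ} (h0 : 0 < ε) (hε : ε < π / 2) (hθ : ε ≤ θ)
    (hθ' : θ ≤ π - ε) :
    pairIntegral ε (cos θ) (sin θ) = -∫ t in (0 : ℝ)..π, bump ε |cos t| := by
  have hshift := integral_bump_mul_abs_cos_sub ε 1 θ
  simp only [one_mul] at hshift
  rw [← hshift, ← intervalIntegral.integral_neg]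
  refine intervalIntegral.integral_congr fun t ht => ?_
  rw [Set.uIcc_of_le pi_pos.le] at ht
  have hπ : ε ≤ π := by linarith [pi_pos]
  have hge : -cos ε ≤ cos (t - θ) := by
    rw [← cos_pi_sub, ← cos_abs (t - θ)]
    exact cos_le_cos_of_nonneg_of_le_pi (abs_nonneg _) (by linarith)
      (abs_le.2 ⟨by linarith [ht.1], by linarith [ht.2]⟩)
  have he : cos θ * cos t + sin θ * sin t = cos (t - θ) := by rw [cos_sub]; ring
  simp only [he]
  rw [bump_eq_zero h0.le hπ (by linarith), zero_sub]
  rcases le_total 0 (cos (t - θ)) with h | h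
  · rw [abs_of_nonneg h]
  · have hcos : 0 ≤ cos ε := cos_nonneg_of_neg_pi_div_two_le_of_le (by linarith [pi_pos]) hε.le
    rw [abs_of_nonpos h, bump_eq_zero h0.le hπ (h.trans hcos),
      bump_eq_zero h0.le hπ (by linarith)]

lemma integral_bump_abs_cos_pos {ε : ℝ} (h0 : 0 < ε) (hε : ε < π / 2) :
    0 < ∫ t in (0 : ℝ)..π, bump ε |cos t| :=
  (intervalIntegral.integral_nonneg pi_pos.le fun _ _ => bump_nonneg ε _).trans_lt
    (integral_bump_mul_abs_cos_lt h0 hε le_rfl one_pos)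

lemma integral_fS_geo {S : Set E3} (hS : S.Finite) (ε : ℝ) (q x : E3) :
    ∫ t in (0 : ℝ)..π, fS S ε (geo q x t) =
      ∑ s ∈ hS.toFinset, pairIntegral ε ⟪s, q⟫ ⟪s, x⟫ := by
  have hinner : ∀ (s : E3) (t : ℝ), ⟪s, geo q x t⟫ = ⟪s, q⟫ * cos t + ⟪s, x⟫ * sin t := by
    intro s t
    simp only [geo, inner_add_right, real_inner_smul_right]
    ring
  have hfun : ∀ t, fS S ε (geo q x t) = ∑ s ∈ hS.toFinset,
      (bump ε (-(⟪s, q⟫ * cos t + ⟪s, x⟫ * sin t)) - bump ε (⟪s, q⟫ * cos t + ⟪s, x⟫ * sin t)) := by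
    intro t
    rw [fS, finsum_mem_eq_finite_toFinset_sum _ hS]
    refine Finset.sum_congr rfl fun s _ => ?_
    rw [← hinner, ← inner_neg_left]
    rfl
  simp only [hfun]
  exact intervalIntegral.integral_finsetSum fun s _ => intervalIntegrable_pair ε _ _

/-- The unit tangent vector at `q` pointing towards `s`. -/
def dirTo (q s : E3) : E3 := (√(1 - ⟪q, s⟫ ^ 2))⁻¹ • (s - ⟪q, s⟫ • q)

lemma dirTo_mem {P : Submodule ℝ E3} {q s : E3} (hq : q ∈ P) (hs : s ∈ P) : dirTo q s ∈ P :=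
  P.smul_mem _ (P.sub_mem hs (P.smul_mem _ hq))

lemma inner_self_dirTo {q s : E3} (hq : ‖q‖ = 1) : ⟪q, dirTo q s⟫ = 0 := by
  simp [dirTo, real_inner_smul_right, inner_sub_right, hq]

lemma inner_target_dirTo {q s : E3} (hs : ‖s‖ = 1) (h : ⟪q, s⟫ ^ 2 < 1) :
    ⟪s, dirTo q s⟫ = √(1 - ⟪q, s⟫ ^ 2) := by
  have hpos : 0 < √(1 - ⟪q, s⟫ ^ 2) := sqrt_pos.2 (by linarith)
  have hsq := sq_sqrt (show 0 ≤ 1 - ⟪q, s⟫ ^ 2 by linarith)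
  rw [dirTo, real_inner_smul_right, inner_sub_right, real_inner_smul_right,
    real_inner_self_eq_norm_sq, hs, real_inner_comm q s, inv_mul_eq_iff_eq_mul₀ hpos.ne']
  linear_combination -hsq

lemma unitTangent_dirTo {q s : E3} (hq : ‖q‖ = 1) (hs : ‖s‖ = 1) (h : ⟪q, s⟫ ^ 2 < 1) :
    UnitTangent q (dirTo q s) := by
  refine ⟨?_, inner_self_dirTo hq⟩
  have hpos : 0 < √(1 - ⟪q, s⟫ ^ 2) := sqrt_pos.2 (by linarith)
  have h1 : ⟪dirTo q s, dirTo q s⟫ = 1 := by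
    conv_lhs => rw [dirTo, real_inner_smul_left, ← dirTo, inner_sub_left, real_inner_smul_left,
      inner_self_dirTo hq, inner_target_dirTo hs h, mul_zero, sub_zero]
    exact inv_mul_cancel₀ hpos.ne'
  rw [real_inner_self_eq_norm_sq] at h1
  exact (pow_eq_one_iff_of_nonneg (norm_nonneg _) two_ne_zero).1 h1

lemma inner_dirTo_of_inner_eq_zero {q s w : E3} (hw : ⟪q, w⟫ = 0) :
    ⟪w, dirTo q s⟫ = (√(1 - ⟪q, s⟫ ^ 2))⁻¹ * ⟪w, s⟫ := by
  rw [dirTo, real_inner_smul_right, inner_sub_right, real_inner_smul_right,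
    real_inner_comm q w, hw, mul_zero, sub_zero]

lemma eq_smul_add_smul_of_one_le {q x t : E3} (hq : ‖q‖ = 1) (hx : UnitTangent q x)
    (ht : ‖t‖ = 1) (h : 1 ≤ ⟪t, q⟫ ^ 2 + ⟪t, x⟫ ^ 2) : t = ⟪t, q⟫ • q + ⟪t, x⟫ • x := by
  have hn : ‖t - (⟪t, q⟫ • q + ⟪t, x⟫ • x)‖ ^ 2 = 1 - (⟪t, q⟫ ^ 2 + ⟪t, x⟫ ^ 2) := by
    rw [← real_inner_self_eq_norm_sq]
    simp only [inner_sub_left, inner_sub_right, inner_add_left, inner_add_right,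
      real_inner_smul_left, real_inner_smul_right, real_inner_self_eq_norm_sq, hq, hx.1, hx.2, ht,
      real_inner_comm t q, real_inner_comm t x, real_inner_comm q x, norm_smul, mul_pow,
      Real.norm_eq_abs, sq_abs]
    ring
  have h0 : ‖t - (⟪t, q⟫ • q + ⟪t, x⟫ • x)‖ = 0 := by
    have := sq_nonneg ‖t - (⟪t, q⟫ • q + ⟪t, x⟫ • x)‖
    exact pow_eq_zero_iff two_ne_zero |>.1 (by linarith)
  exact sub_eq_zero.1 (norm_eq_zero.1 h0)

lemma inner_sq_lt_one_of_inner_pos {p u s : E3} (hp : ‖p‖ = 1) (hu : UnitTangent p u)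
    (hs : ‖s‖ = 1) (h : 0 < ⟪s, u⟫) : ⟪p, s⟫ ^ 2 < 1 := by
  by_contra! hge
  rw [real_inner_comm] at hge
  have := eq_smul_add_smul_of_one_le hp hu hs (by nlinarith [sq_nonneg ⟪s, u⟫])
  have hn := congrArg (fun v => ⟪v, v⟫) this
  simp only [inner_add_left, inner_add_right, real_inner_smul_left, real_inner_smul_right,
    real_inner_self_eq_norm_sq, hp, hu.1, hu.2, hs, real_inner_comm p u, norm_smul,
    mul_pow, Real.norm_eq_abs, sq_abs] at hn
  nlinarith [sq_pos_of_pos h]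

lemma exists_plane (a b : E3) :
    ∃ P : Submodule ℝ E3, Module.finrank ℝ P = 2 ∧ a ∈ P ∧ b ∈ P := by
  have hfin : Module.finrank ℝ E3 = 3 := by simp
  have hne : (Submodule.span ℝ {a, b})ᗮ ≠ ⊥ := by
    intro h
    have h1 := Submodule.finrank_add_finrank_orthogonal (Submodule.span ℝ {a, b})
    rw [h, finrank_bot, hfin] at h1
    have h2 := finrank_span_finset_le_card (R := ℝ) ({a, b} : Finset E3)
    have h3 : ({a, b} : Finset E3).card ≤ 2 := Finset.card_le_two
    rw [Finset.coe_pair, Set.finrank] at h2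
    omega
  obtain ⟨n, hn, hn0⟩ := Submodule.exists_mem_ne_zero_of_ne_bot hne
  have : Fact (Module.finrank ℝ E3 = 2 + 1) := ⟨hfin⟩
  refine ⟨(ℝ ∙ n)ᗮ, Submodule.finrank_orthogonal_span_singleton hn0, ?_, ?_⟩ <;>
  · rw [Submodule.mem_orthogonal_singleton_iff_inner_left]
    exact (Submodule.mem_orthogonal _ _).1 hn _ (Submodule.subset_span (by simp))

/-- Open conditions on `(ε, q, w)` under which every `t ∈ S` other than `s` and `s₀` contributes
nonpositively to the integral of `f^ε_S` along the half great circle from `q` through `s`. -/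
def Admissible (S : Set E3) (s s₀ : E3) (ε : ℝ) (q w : E3) : Prop :=
  0 < ⟪w, s⟫ ∧ ⟪q, s⟫ < cos ε ∧ -cos ε < ⟪q, s⟫ ∧ ∀ t ∈ S, t ≠ s → t ≠ s₀ →
    0 < ⟪t, dirTo q s⟫ ∨ ⟪t, q⟫ ^ 2 + ⟪t, dirTo q s⟫ ^ 2 < cos ε ^ 2

lemma Admissible.inner_sq_lt_one {S : Set E3} {s s₀ q w : E3} {ε : ℝ}
    (h : Admissible S s s₀ ε q w) : ⟪q, s⟫ ^ 2 < 1 := by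
  have := cos_le_one ε
  exact (sq_lt_one_iff_abs_lt_one _).2 (abs_lt.2 ⟨by linarith [h.2.2.1], by linarith [h.2.1]⟩)

lemma eventually_admissible {S : Set E3} (hS : S.Finite) {p u s : E3} (s₀ : E3)
    (hsu : 0 < ⟪s, u⟫) (hps : ⟪p, s⟫ ^ 2 < 1)
    (h : ∀ t ∈ S, t ≠ s → t ≠ s₀ →
      0 < ⟪t, dirTo p s⟫ ∨ ⟪t, p⟫ ^ 2 + ⟪t, dirTo p s⟫ ^ 2 < 1) :
    ∀ᶠ z in nhds ((0 : ℝ), p, u), Admissible S s s₀ z.1 z.2.1 z.2.2 := by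
  have hdir : ContinuousAt (fun z : ℝ × E3 × E3 => dirTo z.2.1 s) (0, p, u) := by
    unfold dirTo
    have hroot : √(1 - ⟪p, s⟫ ^ 2) ≠ 0 := (sqrt_pos.2 (by linarith)).ne'
    have hinv : ContinuousAt (fun z : ℝ × E3 × E3 => (√(1 - ⟪z.2.1, s⟫ ^ 2))⁻¹) (0, p, u) :=
      ContinuousAt.inv₀ (by fun_prop) hroot
    exact hinv.smul (by fun_prop)
  have habs := abs_lt.1 ((sq_lt_one_iff_abs_lt_one _).1 hps)
  refine .and ?_ (.and ?_ (.and ?_ ?_))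
  · rw [real_inner_comm] at hsu
    exact ContinuousAt.eventually_lt (f := fun _ => (0 : ℝ))
      (g := fun z : ℝ × E3 × E3 => ⟪z.2.2, s⟫) (by fun_prop) (by fun_prop) hsu
  · exact ContinuousAt.eventually_lt (f := fun z : ℝ × E3 × E3 => ⟪z.2.1, s⟫)
      (g := fun z : ℝ × E3 × E3 => cos z.1) (by fun_prop) (by fun_prop) (by simpa using habs.2)
  · exact ContinuousAt.eventually_lt (f := fun z : ℝ × E3 × E3 => -cos z.1)
      (g := fun z : ℝ × E3 × E3 => ⟪z.2.1, s⟫) (by fun_prop) (by fun_prop) (by simpa using habs.1)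
  · refine (Filter.eventually_all_finite hS).2 fun t ht => ?_
    by_cases h1 : t = s
    · simp [h1]
    by_cases h2 : t = s₀
    · simp [h2]
    rcases h t ht h1 h2 with h3 | h3
    · filter_upwards [ContinuousAt.eventually_lt (f := fun _ => (0 : ℝ))
        (g := fun z : ℝ × E3 × E3 => ⟪t, dirTo z.2.1 s⟫) (by fun_prop) (by fun_prop) h3]
        with z hz _ _ using Or.inl hz
    · filter_upwards [ContinuousAt.eventually_lt
        (f := fun z : ℝ × E3 × E3 => ⟪t, z.2.1⟫ ^ 2 + ⟪t, dirTo z.2.1 s⟫ ^ 2)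
        (g := fun z : ℝ × E3 × E3 => cos z.1 ^ 2) (by fun_prop) (by fun_prop) (by simpa using h3)]
        with z hz _ _ using Or.inr hz

lemma Admissible.exists_integral_neg {S : Set E3} (hS : S.Finite) {s s₀ q w : E3} {ε : ℝ}
    (h : Admissible S s s₀ ε q w) (hsS : s ∈ S) (hs : ‖s‖ = 1) (hq : ‖q‖ = 1)
    (hw : UnitTangent q w) (h0 : 0 < ε) (hε : ε < π / 2) (hs₀ : s₀ ≠ s)
    (hs₀' : 0 ≤ ⟪s₀, dirTo q s⟫ ∨ ⟪s₀, q⟫ ^ 2 + ⟪s₀, dirTo q s⟫ ^ 2 < 1) :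
    ∃ x : E3, UnitTangent q x ∧ 0 < ⟪w, x⟫ ∧ (∫ t in (0 : ℝ)..π, fS S ε (geo q x t)) < 0 := by
  have hlt := h.inner_sq_lt_one
  obtain ⟨hws, hup, hlow, hother⟩ := h
  refine ⟨dirTo q s, unitTangent_dirTo hq hs hlt, ?_, ?_⟩
  · rw [inner_dirTo_of_inner_eq_zero hw.2]
    exact mul_pos (inv_pos.2 (sqrt_pos.2 (by linarith))) hws
  set M := ∫ t in (0 : ℝ)..π, bump ε |cos t|
  have hM : 0 < M := integral_bump_abs_cos_pos h0 hε
  set I : E3 → ℝ := fun t => pairIntegral ε ⟪t, q⟫ ⟪t, dirTo q s⟫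
  have hIs : I s = -M := by
    have hεπ : ε ≤ π := by linarith [pi_pos]
    have h1 : ⟪s, q⟫ = cos (arccos ⟪q, s⟫) := by
      have := cos_le_one ε
      rw [cos_arccos (by linarith) (by linarith), real_inner_comm]
    have h2 : ⟪s, dirTo q s⟫ = sin (arccos ⟪q, s⟫) := by
      rw [sin_arccos, inner_target_dirTo hs hlt]
    simp only [I]
    rw [h1, h2]
    refine pairIntegral_cos_sin h0 hε ?_ ?_
    · simpa only [arccos_cos h0.le hεπ] using antitone_arccos hup.le
    · have := antitone_arccos hlow.le
      rwa [arccos_neg, arccos_cos h0.le hεπ] at this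
  have hI₀ : I s₀ < M := by
    rcases hs₀' with h | h
    · exact (pairIntegral_nonpos ε _ h).trans_lt hM
    · exact pairIntegral_lt h0 hε h
  have hI : ∀ t ∈ S, t ≠ s → t ≠ s₀ → I t ≤ 0 := by
    intro t ht h1 h2
    rcases hother t ht h1 h2 with h | h
    · exact pairIntegral_nonpos ε _ h.le
    · exact (pairIntegral_eq_zero h0.le hε.le h.le).le
  have hrest : ∑ t ∈ hS.toFinset.erase s, I t < M := by
    by_cases hmem : s₀ ∈ S
    · rw [← Finset.add_sum_erase (a := s₀) _ _ (by simp [hs₀, hmem])]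
      have : ∑ t ∈ (hS.toFinset.erase s).erase s₀, I t ≤ 0 :=
        Finset.sum_nonpos fun t ht => by
          simp only [Finset.mem_erase, Set.Finite.mem_toFinset] at ht
          exact hI t ht.2.2 ht.2.1 ht.1
      linarith
    · refine (Finset.sum_nonpos fun t ht => ?_).trans_lt hM
      simp only [Finset.mem_erase, Set.Finite.mem_toFinset] at ht
      exact hI t ht.2 ht.1 fun h => hmem (h ▸ ht.2)
  rw [integral_fS_geo hS, ← Finset.add_sum_erase _ _ (hS.mem_toFinset.2 hsS)]
  change I s + ∑ t ∈ hS.toFinset.erase s, I t < 0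
  linarith

/-- If the great circle through `q` and `s` meets `t`, then every plane through `q` and `s`
contains `t`. -/
lemma mem_plane_of_one_le {P : Submodule ℝ E3} {q s t : E3} (hq : ‖q‖ = 1) (hs : ‖s‖ = 1)
    (ht : ‖t‖ = 1) (hqs : ⟪q, s⟫ ^ 2 < 1) (hqP : q ∈ P) (hsP : s ∈ P)
    (h : 1 ≤ ⟪t, q⟫ ^ 2 + ⟪t, dirTo q s⟫ ^ 2) : t ∈ P := by
  rw [eq_smul_add_smul_of_one_le hq (unitTangent_dirTo hq hs hqs) ht h]
  exact P.add_mem (P.smul_mem _ hqP) (P.smul_mem _ (dirTo_mem hqP hsP))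

lemma eq_or_eq_neg_of_inner_sq {q t : E3} (hq : ‖q‖ = 1) (ht : ‖t‖ = 1)
    (h : 1 ≤ ⟪t, q⟫ ^ 2) : q = t ∨ q = -t := by
  have h1 : |⟪t, q⟫| ≤ 1 := by simpa [hq, ht] using abs_real_inner_le_norm t q
  have h2 : ⟪t, q⟫ ^ 2 = 1 := le_antisymm ((sq_le_one_iff_abs_le_one _).2 h1) h
  rcases eq_or_eq_neg_of_sq_eq_sq ⟪t, q⟫ 1 (by rw [h2, one_pow]) with h3 | h3
  · exact Or.inl ((inner_eq_one_iff_of_norm_eq_one ht hq).1 h3).symm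
  · refine Or.inr ?_
    rw [← neg_eq_iff_eq_neg, eq_comm]
    exact (inner_eq_one_iff_of_norm_eq_one (𝕜 := ℝ) ht (by simpa using hq)).1 (by simp [h3])

/-- If the great circle through `q` and `s` meets `t ≠ ±q`, then every plane through `q` and `t`
contains `s`. -/
lemma mem_plane_swap {P : Submodule ℝ E3} {q s t : E3} (hq : ‖q‖ = 1) (hs : ‖s‖ = 1)
    (ht : ‖t‖ = 1) (hqs : ⟪q, s⟫ ^ 2 < 1) (hqP : q ∈ P) (htP : t ∈ P)
    (hqt : ⟪t, q⟫ ^ 2 < 1) (h : 1 ≤ ⟪t, q⟫ ^ 2 + ⟪t, dirTo q s⟫ ^ 2) : s ∈ P := by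
  have heq := eq_smul_add_smul_of_one_le hq (unitTangent_dirTo hq hs hqs) ht h
  have hb : ⟪t, dirTo q s⟫ ≠ 0 := fun h0 => by rw [h0] at h; linarith
  have hmem : ⟪t, dirTo q s⟫ • dirTo q s ∈ P := by
    rw [← sub_eq_iff_eq_add'.2 heq]
    exact P.sub_mem htP (P.smul_mem _ hqP)
  have hdir := (P.smul_mem_iff hb).1 hmem
  have hr : (√(1 - ⟪q, s⟫ ^ 2))⁻¹ ≠ 0 := inv_ne_zero (sqrt_pos.2 (by linarith)).ne'
  have := P.add_mem ((P.smul_mem_iff hr).1 hdir) (P.smul_mem ⟪q, s⟫ hqP)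
  simpa using this

lemma Fine.not_mem_plane {S : Set E3} (hS : Fine S) {x y z : E3} (hx : x ∈ S) (hy : y ∈ S)
    (hz : z ∈ S) (hxy : x ≠ y) (hyz : y ≠ z) (hxz : x ≠ z) {P : Submodule ℝ E3}
    (hP : Module.finrank ℝ P = 2) (hxP : x ∈ P) (hyP : y ∈ P) : z ∉ P := fun hzP =>
  hS.2.2.1 x hx y hy z hz hxy hyz hxz _ ⟨P, hP, rfl⟩ ⟨hS.2.1 hx, hxP⟩ ⟨hS.2.1 hy, hyP⟩
    ⟨hS.2.1 hz, hzP⟩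

lemma Fine.exists_triple {S : Set E3} (hS : Fine S) {u : E3} (hu : ‖u‖ = 1) :
    ∃ a b c, (a ∈ S ∧ 0 < ⟪a, u⟫) ∧ (b ∈ S ∧ 0 < ⟪b, u⟫) ∧ (c ∈ S ∧ 0 < ⟪c, u⟫) ∧
      a ≠ b ∧ a ≠ c ∧ b ≠ c := by
  have h := hS.2.2.2.2 u hu
  have hfin : {x ∈ S | 0 < ⟪x, u⟫}.Finite := hS.1.subset fun x hx => hx.1
  obtain ⟨a, b, c, ha, hb, hc, h1, h2, h3⟩ := (Set.two_lt_ncard_iff hfin).1 h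
  exact ⟨a, b, c, ha, hb, hc, h1, h2, h3⟩

/-- At a point off `S ∪ -S`, in each open half-plane of directions some half great circle
passes through a point of `S` and avoids `-S`. -/
lemma Fine.exists_good_direction {S : Set E3} (hS : Fine S) {p u : E3} (hp : ‖p‖ = 1)
    (hu : UnitTangent p u) (hpS : p ∉ S ∪ (-S)) :
    ∃ s ∈ S, 0 < ⟪s, u⟫ ∧ ∀ t ∈ S, t ≠ s →
      0 < ⟪t, dirTo p s⟫ ∨ ⟪t, p⟫ ^ 2 + ⟪t, dirTo p s⟫ ^ 2 < 1 := by
  have hnorm : ∀ {s}, s ∈ S → ‖s‖ = 1 := fun hs => hS.2.1 hs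
  by_contra! hcon
  have hbad : ∀ s, s ∈ S ∧ 0 < ⟪s, u⟫ → ∃ (P : Submodule ℝ E3) (t : E3),
      Module.finrank ℝ P = 2 ∧ p ∈ P ∧ s ∈ P ∧ t ∈ S ∧ t ≠ s ∧ t ∈ P ∧ ⟪t, u⟫ < 0 := by
    rintro s ⟨hs, hsu⟩
    obtain ⟨t, ht, hts, hle, hone⟩ := hcon s hs hsu
    obtain ⟨P, hP, hpP, hsP⟩ := exists_plane p s
    have hps := inner_sq_lt_one_of_inner_pos hp hu (hnorm hs) hsu
    refine ⟨P, t, hP, hpP, hsP, ht, hts,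
      mem_plane_of_one_le hp (hnorm hs) (hnorm ht) hps hpP hsP hone, ?_⟩
    have hneg : ⟪t, dirTo p s⟫ < 0 := by
      refine lt_of_le_of_ne hle fun h0 => hpS ?_
      rw [h0] at hone
      rcases eq_or_eq_neg_of_inner_sq hp (hnorm ht) (by simpa using hone) with h | h
      · exact Or.inl (h ▸ ht)
      · exact Or.inr (by rw [Set.mem_neg, h, neg_neg]; exact ht)
    have heq := eq_smul_add_smul_of_one_le hp (unitTangent_dirTo hp (hnorm hs) hps)
      (hnorm ht) hone
    have hpos : 0 < ⟪u, dirTo p s⟫ := by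
      rw [inner_dirTo_of_inner_eq_zero hu.2, real_inner_comm s u]
      exact mul_pos (inv_pos.2 (sqrt_pos.2 (by linarith))) hsu
    rw [heq, inner_add_left, real_inner_smul_left, real_inner_smul_left, hu.2, mul_zero,
      zero_add, real_inner_comm u]
    exact mul_neg_of_neg_of_pos hneg hpos
  obtain ⟨a, b, c, ha, hb, hc, hab, hac, hbc⟩ := hS.exists_triple hu.1
  have hne : ∀ {s s' t : E3} {P P' : Submodule ℝ E3}, s ∈ S → s' ∈ S ∧ 0 < ⟪s', u⟫ → s ≠ s' →
      Module.finrank ℝ P = 2 → s ∈ P → t ∈ S → t ≠ s → t ∈ P → ⟪t, u⟫ < 0 → s' ∈ P' →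
      sphere2 ∩ (P : Set E3) ≠ sphere2 ∩ (P' : Set E3) := by
    intro s s' t P P' hs hs' hss' hP hsP ht hts htP htu hs'P' heq
    have hts' : t ≠ s' := fun h => by
      have := hs'.2
      rw [← h] at this
      exact lt_asymm this htu
    have hmem : s' ∈ sphere2 ∩ (P : Set E3) := heq ▸ ⟨hS.2.1 hs'.1, hs'P'⟩
    exact hS.not_mem_plane hs ht hs'.1 hts.symm hts' hss' hP hsP htP hmem.2
  obtain ⟨Pa, ta, hPa, hpa, haP, hta, htaa, htaP, htau⟩ := hbad a ha
  obtain ⟨Pb, tb, hPb, hpb, hbP, htb, htbb, htbP, htbu⟩ := hbad b hb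
  obtain ⟨Pc, tc, hPc, hpc, hcP, htc, htcc, htcP, htcu⟩ := hbad c hc
  refine hpS (hS.2.2.2.1 _ _ _ ⟨Pa, hPa, rfl⟩ ⟨Pb, hPb, rfl⟩ ⟨Pc, hPc, rfl⟩
    (hne ha.1 hb hab hPa haP hta htaa htaP htau hbP)
    (hne hb.1 hc hbc hPb hbP htb htbb htbP htbu hcP)
    (hne ha.1 hc hac hPa haP hta htaa htaP htau hcP)
    ⟨a, ha.1, ta, hta, htaa.symm, ⟨hS.2.1 ha.1, haP⟩, ⟨hS.2.1 hta, htaP⟩⟩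
    ⟨b, hb.1, tb, htb, htbb.symm, ⟨hS.2.1 hb.1, hbP⟩, ⟨hS.2.1 htb, htbP⟩⟩
    ⟨c, hc.1, tc, htc, htcc.symm, ⟨hS.2.1 hc.1, hcP⟩, ⟨hS.2.1 htc, htcP⟩⟩
    p hp ⟨hp, hpa⟩ ⟨hp, hpb⟩ ⟨hp, hpc⟩)

lemma Fine.eventually_exists_integral_neg {S : Set E3} (hS : Fine S) {p u : E3} (hp : ‖p‖ = 1)
    (hu : UnitTangent p u) :
    ∀ᶠ z in nhds ((0 : ℝ), p, u), ‖z.2.1‖ = 1 → UnitTangent z.2.1 z.2.2 → 0 < z.1 →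
      ∃ x : E3, UnitTangent z.2.1 x ∧ 0 < ⟪z.2.2, x⟫ ∧
        (∫ t in (0 : ℝ)..π, fS S z.1 (geo z.2.1 x t)) < 0 := by
  have hnorm : ∀ {s}, s ∈ S → ‖s‖ = 1 := fun hs => hS.2.1 hs
  have hsmall : ∀ᶠ z : ℝ × E3 × E3 in nhds ((0 : ℝ), p, u), z.1 < π / 2 :=
    ContinuousAt.eventually_lt (by fun_prop) continuousAt_const (by simpa using pi_pos)
  by_cases hpS : p ∈ S ∪ (-S)
  · obtain ⟨s₀, hs₀, hps₀⟩ : ∃ s₀ ∈ S, p = s₀ ∨ p = -s₀ := by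
      rcases hpS with h | h
      · exact ⟨p, h, Or.inl rfl⟩
      · exact ⟨-p, h, Or.inr (neg_neg p).symm⟩
    have hs₀u : ⟪s₀, u⟫ = 0 := by
      rcases hps₀ with h | h <;> simpa [h] using hu.2
    have hadm : ∀ s, s ∈ S ∧ 0 < ⟪s, u⟫ →
        s₀ ≠ s ∧ ∀ᶠ z in nhds ((0 : ℝ), p, u), Admissible S s s₀ z.1 z.2.1 z.2.2 := by
      rintro s ⟨hs, hsu⟩
      have hss₀ : s₀ ≠ s := fun h => by rw [← h, hs₀u] at hsu; exact lt_irrefl _ hsu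
      have hps := inner_sq_lt_one_of_inner_pos hp hu (hnorm hs) hsu
      refine ⟨hss₀, eventually_admissible hS.1 s₀ hsu hps fun t ht hts hts₀ => Or.inr ?_⟩
      by_contra! hone
      obtain ⟨P, hP, hpP, hsP⟩ := exists_plane p s
      have hs₀P : s₀ ∈ P := by
        rcases hps₀ with h | h
        · exact h ▸ hpP
        · rw [h] at hpP; simpa using hpP
      exact hS.not_mem_plane hs₀ hs ht hss₀ hts.symm hts₀.symm hP hs₀P hsP
        (mem_plane_of_one_le hp (hnorm hs) (hnorm ht) hps hpP hsP hone)
    obtain ⟨a, b, -, ha, hb, -, hab, -, -⟩ := hS.exists_triple hu.1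
    filter_upwards [hsmall, (hadm a ha).2, (hadm b hb).2] with z hz hza hzb hq hw h0
    by_cases hpar : 1 ≤ ⟪s₀, z.2.1⟫ ^ 2
    · refine hza.exists_integral_neg hS.1 ha.1 (hnorm ha.1) hq hw h0 hz (hadm a ha).1
        (Or.inl (le_of_eq ?_))
      have := inner_self_dirTo (s := a) hq
      rcases eq_or_eq_neg_of_inner_sq hq (hnorm hs₀) hpar with h | h
      · nth_rewrite 1 [h] at this
        exact this.symm
      · nth_rewrite 1 [h] at this
        rw [inner_neg_left, neg_eq_zero] at this
        exact this.symm
    · push Not at hpar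
      by_cases ha1 : ⟪s₀, z.2.1⟫ ^ 2 + ⟪s₀, dirTo z.2.1 a⟫ ^ 2 < 1
      · exact hza.exists_integral_neg hS.1 ha.1 (hnorm ha.1) hq hw h0 hz (hadm a ha).1
          (Or.inr ha1)
      refine hzb.exists_integral_neg hS.1 hb.1 (hnorm hb.1) hq hw h0 hz (hadm b hb).1
        (Or.inr ?_)
      by_contra! hb1
      push Not at ha1
      obtain ⟨P, hP, hqP, hs₀P⟩ := exists_plane z.2.1 s₀
      exact hS.not_mem_plane hs₀ ha.1 hb.1 (hadm a ha).1 hab (hadm b hb).1 hP hs₀P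
        (mem_plane_swap hq (hnorm ha.1) (hnorm hs₀) hza.inner_sq_lt_one hqP hs₀P hpar ha1)
        (mem_plane_swap hq (hnorm hb.1) (hnorm hs₀) hzb.inner_sq_lt_one hqP hs₀P hpar hb1)
  · obtain ⟨s, hs, hsu, hgood⟩ := hS.exists_good_direction hp hu hpS
    have hps := inner_sq_lt_one_of_inner_pos hp hu (hnorm hs) hsu
    filter_upwards [hsmall, eventually_admissible hS.1 0 hsu hps fun t ht hts _ => hgood t ht hts]
      with z hz hadm hq hw h0
    refine hadm.exists_integral_neg hS.1 hs (hnorm hs) hq hw h0 hz ?_ (by simp)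
    rintro rfl
    simp at hsu

/-- Around every unit tangent vector `u` at a point `p` of the sphere there are
`ε₁ ∈ (0,ε₀)` and a neighborhood of size `η` such that for every nearby unit
tangent vector `w` at a nearby point `q` and every `ε ∈ (0,ε₁)`, some great
half-circle from `q` making an acute angle with `w` integrates `f^ε_S`
negatively. -/
theorem fS_locally_good
    (S : Set E3) (hS : Fine S) (ε₀ : ℝ) (hε₀ : 0 < ε₀)
    (hdisj : ∀ s ∈ S ∪ (-S), ∀ s' ∈ S ∪ (-S), s ≠ s' →
      Disjoint {x ∈ sphere2 | rho x s ≤ ε₀} {x ∈ sphere2 | rho x s' ≤ ε₀})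
    (hball : ∀ p ∈ sphere2, 3 ≤ {x ∈ S | rho x p < π / 2 - ε₀}.ncard) :
    ∀ p ∈ sphere2, ∀ u : E3, UnitTangent p u →
      ∃ ε₁ : ℝ, 0 < ε₁ ∧ ε₁ < ε₀ ∧ ∃ η > (0:ℝ),
        ∀ q ∈ sphere2, ∀ w : E3, UnitTangent q w →
          ‖q - p‖ < η → ‖w - u‖ < η →
          ∀ ε : ℝ, 0 < ε → ε < ε₁ →
            ∃ x : E3, UnitTangent q x ∧ 0 < ⟪w, x⟫ ∧
              (∫ t in (0:ℝ)..π, fS S ε (geo q x t)) < 0 := by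
  intro p hp u hu
  obtain ⟨r, hr, h⟩ := Metric.eventually_nhds_iff.1 (hS.eventually_exists_integral_neg hp hu)
  refine ⟨min r (ε₀ / 2), by positivity, (min_le_right _ _).trans_lt (by linarith), r, hr, ?_⟩
  intro q hq w hw hqp hwu ε h0 hε
  refine h (y := (ε, q, w)) ?_ hq hw h0
  rw [Prod.dist_eq, Prod.dist_eq, max_lt_iff, max_lt_iff, dist_eq_norm, dist_eq_norm,
    dist_eq_norm, sub_zero, Real.norm_of_nonneg h0.le]
  exact ⟨hε.trans_le (min_le_left _ _), hqp, hwu⟩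
end
end

section
/- There exists an odd L-good function f : S² → ℝ which is smooth (C^∞ as a function on the sphere, e.g., the restriction to S² of a C^∞ function defined on a neighborhood of S² in ℝ³). -/
open scoped RealInnerProductSpace
open Real

noncomputable section

/-- `f` is L-good: at every point of the sphere and in every open semicircle of
tangent directions there is a direction whose great half-circle integrates `f`
negatively. -/
def LGood (f : E3 → ℝ) : Prop :=
  ∀ p ∈ sphere2, ∀ u : E3, UnitTangent p u →
    ∃ v : E3, UnitTangent p v ∧ 0 < ⟪u, v⟫ ∧ (∫ t in (0:ℝ)..π, f (geo p v t)) < 0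

open Set Filter Topology

/-- The half-width, in logarithmic scale, of the bumps of `profile`. -/
def bumpWidth : ℝ := 1 / 10 ^ 12

/-- The tent function of height `1` supported in `[-bumpWidth, bumpWidth]`, for arguments `≥ 0`. -/
def tent (r : ℝ) : ℝ := max (1 - r / bumpWidth) 0

/-- An odd function of `c ∈ [-1, 1]` with a narrow positive bump at `1` and a negative one at
`-1`. -/
def signedTent (c : ℝ) : ℝ := tent (arccos c) - tent (arccos (-c))

/-- A continuous function with bumps of alternating sign at the points `exp (n * π)`, satisfying
the scaling relation `profile (exp π * y) = -exp π * profile y`. -/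
def profile (y : ℝ) : ℝ := y * signedTent (cos (log y))

lemma bumpWidth_pos : 0 < bumpWidth := by norm_num [bumpWidth]

lemma tent_nonneg (r : ℝ) : 0 ≤ tent r := le_max_right _ _

lemma tent_le_one {r : ℝ} (hr : 0 ≤ r) : tent r ≤ 1 :=
  max_le (by linarith [div_nonneg hr bumpWidth_pos.le]) zero_le_one

lemma tent_eq_zero {r : ℝ} (hr : bumpWidth ≤ r) : tent r = 0 := by
  refine max_eq_right ?_
  have := (one_le_div bumpWidth_pos).2 hr
  linarith

lemma half_le_tent {r : ℝ} (hr : r ≤ bumpWidth / 2) : 1 / 2 ≤ tent r := by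
  refine le_max_of_le_left ?_
  have : r / bumpWidth ≤ 1 / 2 := by
    rw [div_le_iff₀ bumpWidth_pos]; linarith
  linarith

lemma continuous_signedTent : Continuous signedTent := by
  unfold signedTent tent
  fun_prop

lemma signedTent_neg (c : ℝ) : signedTent (-c) = -signedTent c := by
  simp [signedTent]

lemma abs_signedTent_le_one (c : ℝ) : |signedTent c| ≤ 1 := by
  have h1 := tent_nonneg (arccos c)
  have h2 := tent_nonneg (arccos (-c))
  have h3 := tent_le_one (arccos_nonneg c)
  have h4 := tent_le_one (arccos_nonneg (-c))
  rw [signedTent, abs_le]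
  constructor <;> linarith

lemma signedTent_eq_tent {c : ℝ} (hc : 0 ≤ c) : signedTent c = tent (arccos c) := by
  have h : bumpWidth ≤ arccos (-c) := by
    have h1 : arccos 0 ≤ arccos (-c) := arccos_le_arccos (by linarith)
    rw [arccos_zero] at h1
    have h2 : bumpWidth ≤ 1 := by norm_num [bumpWidth]
    linarith [pi_gt_three]
  rw [signedTent, tent_eq_zero h, sub_zero]

lemma signedTent_nonneg {c : ℝ} (hc : 0 ≤ c) : 0 ≤ signedTent c := by
  rw [signedTent_eq_tent hc]; exact tent_nonneg _

lemma arccos_cos_eq_abs {x : ℝ} (hx : |x| ≤ π) : arccos (cos x) = |x| := by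
  rw [← cos_abs, arccos_cos (abs_nonneg x) hx]

lemma abs_profile_le (y : ℝ) : |profile y| ≤ |y| := by
  rw [profile, abs_mul]
  exact mul_le_of_le_one_right (abs_nonneg y) (abs_signedTent_le_one _)

lemma continuous_profile : Continuous profile := by
  rw [continuous_iff_continuousAt]
  intro y
  rcases eq_or_ne y 0 with rfl | hy
  · have h0 : profile 0 = 0 := by simp [profile]
    rw [ContinuousAt, h0]
    refine squeeze_zero_norm (a := fun y : ℝ => |y|) (fun y => abs_profile_le y) ?_
    simpa using (continuous_abs (G := ℝ)).tendsto 0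
  · exact continuousAt_id.mul
      ((continuous_signedTent.comp continuous_cos).continuousAt.comp (continuousAt_log hy))

lemma profile_exp_int_mul_pi_mul (n : ℤ) {y : ℝ} (hy : 0 < y) :
    profile (exp (n * π) * y) = (-1) ^ n * exp (n * π) * profile y := by
  have hlog : log (exp (n * π) * y) = log y + n * π := by
    rw [log_mul (exp_ne_zero _) hy.ne', log_exp, add_comm]
  rw [profile, profile, hlog, cos_add_int_mul_pi]
  rcases Int.even_or_odd n with h | h
  · simp [h.neg_one_zpow, mul_assoc]
  · simp [h.neg_one_zpow, signedTent_neg, mul_assoc]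

lemma profile_nonneg_of_cos_nonneg {y : ℝ} (hy : 0 ≤ y) (h : 0 ≤ cos (log y)) : 0 ≤ profile y :=
  mul_nonneg hy (signedTent_nonneg h)

lemma profile_eq_zero_of_log_mem {y : ℝ} (h1 : π / 2 ≤ log y) (h2 : log y ≤ 3 * π / 2)
    (h : bumpWidth ≤ |log y - π|) : profile y = 0 := by
  have hcos : cos (log y) = -cos (log y - π) := by rw [cos_sub_pi, neg_neg]
  have habs : |log y - π| ≤ π / 2 := abs_le.2 ⟨by linarith, by linarith⟩
  rw [profile, hcos, signedTent_neg, signedTent_eq_tent, arccos_cos_eq_abs, tent_eq_zero h]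
  · simp
  · linarith [pi_pos]
  · exact cos_nonneg_of_mem_Icc (abs_le.1 habs)

lemma quarter_le_profile {y : ℝ} (hy : |y - 1| ≤ bumpWidth / 4) : 1 / 4 ≤ profile y := by
  have hδ : bumpWidth = 1 / 10 ^ 12 := rfl
  obtain ⟨h1, h2⟩ := abs_le.1 hy
  rw [hδ] at h1
  have hy0 : 0 < y := by linarith
  have hlog : |log y| ≤ bumpWidth / 2 := by
    refine abs_le.2 ⟨?_, ?_⟩
    · have h3 := one_sub_inv_le_log_of_pos hy0
      have h4 : y⁻¹ ≤ 1 + bumpWidth / 2 := by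
        rw [inv_le_iff_one_le_mul₀ hy0, hδ]
        linarith
      linarith
    · have := log_le_sub_one_of_pos hy0
      linarith [bumpWidth_pos]
  have hpi : |log y| ≤ π / 2 := by
    have : bumpWidth / 2 ≤ 1 := by norm_num [bumpWidth]
    linarith [pi_gt_three]
  have hT : 1 / 2 ≤ signedTent (cos (log y)) := by
    rw [signedTent_eq_tent (cos_nonneg_of_mem_Icc (abs_le.1 hpi)),
      arccos_cos_eq_abs (by linarith [pi_pos])]
    exact half_le_tent hlog
  have hy2 : 1 / 2 ≤ y := by linarith
  calc (1 / 4 : ℝ) = 1 / 2 * (1 / 2) := by norm_num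
    _ ≤ y * signedTent (cos (log y)) := by gcongr

open MeasureTheory in
lemma intervalIntegral_indicator_Icc_const {a b α β : ℝ} (hab : a ≤ b) (c : ℝ) :
    ∫ y in a..b, (Icc α β).indicator (fun _ => c) y = volume.real (Ioc a b ∩ Icc α β) * c := by
  rw [intervalIntegral.integral_of_le hab, setIntegral_indicator measurableSet_Icc,
    setIntegral_const, smul_eq_mul]

open MeasureTheory in
lemma intervalIntegrable_indicator_Icc_const (a b α β c : ℝ) :
    IntervalIntegrable ((Icc α β).indicator (fun _ => c)) volume a b := by
  rw [intervalIntegrable_iff]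
  exact (integrableOn_const (by simp)).indicator measurableSet_Icc

lemma exp_pi_add_bumpWidth_le : exp (π + bumpWidth) ≤ 60 := by
  have hδ : bumpWidth = 1 / 10 ^ 12 := rfl
  have h : π + bumpWidth ≤ 4 := by linarith [pi_lt_d2]
  have h1 : exp (π + bumpWidth) ≤ exp 1 ^ 4 := by
    rw [← exp_nat_mul]
    exact exp_le_exp.2 (by norm_num; exact h)
  have h2 : exp 1 ^ 4 ≤ 2.72 ^ 4 := by
    gcongr
    linarith [exp_one_lt_d9]
  calc exp (π + bumpWidth) ≤ 2.72 ^ 4 := h1.trans h2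
    _ ≤ 60 := by norm_num

lemma sq_le_of_le_sqrt {x y : ℝ} (hx : 0 ≤ x) (hy : 0 ≤ y) (h : x ≤ √y) : x ^ 2 ≤ y :=
  (pow_le_pow_left₀ hx h 2).trans_eq (sq_sqrt hy)

lemma exp_pi_add_sub_exp_pi_sub_le :
    exp (π + bumpWidth) - exp (π - bumpWidth) ≤ 120 * bumpWidth := by
  have h : exp (π - bumpWidth) = exp (π + bumpWidth) * exp (-2 * bumpWidth) := by
    rw [← exp_add]; ring_nf
  calc exp (π + bumpWidth) - exp (π - bumpWidth)
      = exp (π + bumpWidth) * (1 - exp (-2 * bumpWidth)) := by rw [h]; ring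
    _ ≤ exp (π + bumpWidth) * (2 * bumpWidth) := by
      gcongr
      linarith [add_one_le_exp (-2 * bumpWidth)]
    _ ≤ 60 * (2 * bumpWidth) :=
      mul_le_mul_of_nonneg_right exp_pi_add_bumpWidth_le (by linarith [bumpWidth_pos])
    _ = 120 * bumpWidth := by ring

lemma profile_add_sq_ge {W b y : ℝ} (hW : exp (-2 * bumpWidth) ≤ W) (hW1 : W ≤ 1)
    (hD : W + b ^ 2 ≤ exp (5 * π / 2)) (hy : y ∈ Icc 0 b) :
    (Icc √(1 - bumpWidth / 4 - W) √(1 + bumpWidth / 4 - W)).indicator (fun _ => (1 / 4 : ℝ)) y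
      - (Icc √(exp (π - bumpWidth) - W) √(exp (π + bumpWidth) - W)).indicator
        (fun _ => (60 : ℝ)) y ≤ profile (W + y ^ 2) := by
  have hδ : bumpWidth = 1 / 10 ^ 12 := rfl
  have hδ0 := bumpWidth_pos
  have hWpos : 0 < W := (exp_pos _).trans_le hW
  have hzpos : 0 < W + y ^ 2 := by positivity
  set J := Icc √(exp (π - bumpWidth) - W) √(exp (π + bumpWidth) - W) with hJ
  have hJ0 : 0 ≤ J.indicator (fun _ => (60 : ℝ)) y :=
    indicator_nonneg (fun _ _ => by norm_num) y
  by_cases hI : y ∈ Icc √(1 - bumpWidth / 4 - W) √(1 + bumpWidth / 4 - W)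
  · rw [indicator_of_mem hI]
    have h1 := (sqrt_le_left hy.1).1 hI.1
    have h2 := sq_le_of_le_sqrt hy.1 (by linarith) hI.2
    have := quarter_le_profile (y := W + y ^ 2) (abs_le.2 ⟨by linarith, by linarith⟩)
    linarith
  · rw [indicator_of_notMem hI]
    rcases le_or_gt 0 (cos (log (W + y ^ 2))) with hc | hc
    · linarith [profile_nonneg_of_cos_nonneg hzpos.le hc]
    have hx1 : π / 2 ≤ log (W + y ^ 2) := by
      by_contra! h
      refine hc.not_ge (cos_nonneg_of_mem_Icc ⟨?_, h.le⟩)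
      have : -2 * bumpWidth ≤ log (W + y ^ 2) := by
        rw [le_log_iff_exp_le hzpos]
        nlinarith
      linarith [pi_gt_three]
    have hx2 : log (W + y ^ 2) ≤ 3 * π / 2 := by
      by_contra! h
      have h5 : log (W + y ^ 2) ≤ 5 * π / 2 := by
        rw [log_le_iff_le_exp hzpos]
        nlinarith [hy.1, hy.2]
      refine hc.not_ge ?_
      rw [← cos_sub_two_pi]
      exact cos_nonneg_of_mem_Icc ⟨by linarith, by linarith⟩
    by_cases hyJ : y ∈ J
    · rw [indicator_of_mem hyJ]
      have h1 := sq_le_of_le_sqrt hy.1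
        (by linarith [add_one_le_exp (π + bumpWidth), pi_pos]) hyJ.2
      have h2 := (abs_le.1 (abs_profile_le (W + y ^ 2))).1
      rw [abs_of_pos hzpos] at h2
      linarith [exp_pi_add_bumpWidth_le]
    · rw [indicator_of_notMem hyJ, profile_eq_zero_of_log_mem hx1 hx2]
      · norm_num
      · by_contra! h
        obtain ⟨h1, h2⟩ := abs_lt.1 h
        have h3 := (lt_log_iff_exp_lt hzpos).1 (show π - bumpWidth < _ by linarith)
        have h4 := (log_lt_iff_lt_exp hzpos).1 (show _ < π + bumpWidth by linarith)
        exact hyJ ⟨(sqrt_le_left hy.1).2 (by linarith), le_sqrt_of_sq_le (by linarith)⟩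

lemma integral_profile_add_sq_pos {W b : ℝ} (hW1 : exp (-2 * bumpWidth) ≤ W)
    (hW2 : W ≤ exp (-bumpWidth)) (hb : 0 ≤ b) (hD1 : exp (π / 2) ≤ W + b ^ 2)
    (hD2 : W + b ^ 2 ≤ exp (5 * π / 2)) : 0 < ∫ y in (0 : ℝ)..b, profile (W + y ^ 2) := by
  have hδ : bumpWidth = 1 / 10 ^ 12 := rfl
  have hδ0 := bumpWidth_pos
  have hWl : 1 - 2 * bumpWidth ≤ W := by linarith [add_one_le_exp (-2 * bumpWidth)]
  have hWu : W ≤ 1 - bumpWidth / 4 := by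
    refine hW2.trans ?_
    rw [exp_neg, inv_le_iff_one_le_mul₀ (exp_pos _)]
    have h1 := add_one_le_exp bumpWidth
    have h2 : 0 ≤ 1 - bumpWidth / 4 := by linarith
    nlinarith
  set α := √(1 - bumpWidth / 4 - W) with hα
  set β := √(1 + bumpWidth / 4 - W) with hβ
  set γ := √(exp (π - bumpWidth) - W) with hγ
  set ζ := √(exp (π + bumpWidth) - W) with hζ
  have hα2 : α ^ 2 = 1 - bumpWidth / 4 - W := sq_sqrt (by linarith)
  have hβ2 : β ^ 2 = 1 + bumpWidth / 4 - W := sq_sqrt (by linarith)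
  have he2 : 3 ≤ exp (π - bumpWidth) := by linarith [add_one_le_exp (π - bumpWidth), pi_gt_three]
  have hee : exp (π - bumpWidth) ≤ exp (π + bumpWidth) := exp_le_exp.2 (by linarith)
  have hγ2 : γ ^ 2 = exp (π - bumpWidth) - W := sq_sqrt (by linarith)
  have hζ2 : ζ ^ 2 = exp (π + bumpWidth) - W := sq_sqrt (by linarith)
  have hα0 : 0 ≤ α := sqrt_nonneg _
  have hβ0 : 0 ≤ β := sqrt_nonneg _
  have hγ1 : 1 ≤ γ := by
    rw [hγ, one_le_sqrt]; linarith
  have hζγ : γ ≤ ζ := sqrt_le_sqrt (by linarith)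
  have hαβ : α ≤ β := sqrt_le_sqrt (by linarith)
  have hβb : β ≤ b := by
    refine (sqrt_le_left hb).2 ?_
    linarith [add_one_le_exp (π / 2), pi_gt_three]
  have hβu : β ≤ 3 / 2 * (1 / 10 ^ 6) := by
    refine (sqrt_le_left (by norm_num)).2 ?_
    rw [hδ] at *
    norm_num
    linarith
  have hlen : 1 / (6 * 10 ^ 6) ≤ β - α := by
    have h1 : (β - α) * (β + α) = bumpWidth / 2 := by linear_combination hβ2 - hα2
    have h2 : (β - α) * (β + α) ≤ (β - α) * (3 / 10 ^ 6) :=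
      mul_le_mul_of_nonneg_left (by linarith) (by linarith)
    linarith
  have hlen' : ζ - γ ≤ 60 * bumpWidth := by
    have h1 : (ζ - γ) * (ζ + γ) = exp (π + bumpWidth) - exp (π - bumpWidth) := by
      linear_combination hζ2 - hγ2
    have h2 := exp_pi_add_sub_exp_pi_sub_le
    have h3 : (ζ - γ) * 2 ≤ (ζ - γ) * (ζ + γ) :=
      mul_le_mul_of_nonneg_left (by linarith) (by linarith)
    linarith
  have hcont : Continuous fun y : ℝ => profile (W + y ^ 2) :=
    continuous_profile.comp (by fun_prop)
  have hmono := intervalIntegral.integral_mono_on hb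
    ((intervalIntegrable_indicator_Icc_const 0 b α β (1 / 4)).sub
      (intervalIntegrable_indicator_Icc_const 0 b γ ζ 60))
    (hcont.intervalIntegrable 0 b) (fun y hy => profile_add_sq_ge hW1 (by linarith) hD2 hy)
  refine lt_of_lt_of_le ?_ hmono
  rw [intervalIntegral.integral_sub (intervalIntegrable_indicator_Icc_const _ _ _ _ _)
    (intervalIntegrable_indicator_Icc_const _ _ _ _ _),
    intervalIntegral_indicator_Icc_const hb, intervalIntegral_indicator_Icc_const hb]
  have hm1 : β - α ≤ MeasureTheory.volume.real (Ioc 0 b ∩ Icc α β) := by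
    rw [← Real.volume_real_Ioc_of_le hαβ]
    refine MeasureTheory.measureReal_mono ?_ ?_
    · exact fun y hy => ⟨⟨hα0.trans_lt hy.1, hy.2.trans hβb⟩, hy.1.le, hy.2⟩
    · exact ((MeasureTheory.measure_mono inter_subset_left).trans_lt (by simp)).ne
  have hm2 : MeasureTheory.volume.real (Ioc 0 b ∩ Icc γ ζ) ≤ ζ - γ := by
    rw [← Real.volume_real_Icc_of_le hζγ]
    exact MeasureTheory.measureReal_mono inter_subset_right (by simp)
  rw [hδ] at hlen'
  linarith

/-- The zonal odd function `x ↦ x₃ * k (1 - x₃ ^ 2)` on `ℝ³`. -/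
def zonal (k : ℝ → ℝ) (x : E3) : ℝ := x 2 * k (1 - x 2 ^ 2)

lemma integral_neg_self_comp_sq {g : ℝ → ℝ} (hg : Continuous g) (b : ℝ) :
    ∫ y in -b..b, g (y ^ 2) = 2 * ∫ y in (0 : ℝ)..b, g (y ^ 2) := by
  have hc : Continuous fun y : ℝ => g (y ^ 2) := hg.comp (by fun_prop)
  rw [← intervalIntegral.integral_add_adjacent_intervals (hc.intervalIntegrable (-b) 0)
    (hc.intervalIntegrable 0 b)]
  have h := intervalIntegral.integral_comp_neg (a := 0) (b := b) fun y : ℝ => g (y ^ 2)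
  simp only [even_two.neg_pow, neg_zero] at h
  rw [← h]; ring

lemma integral_zonal_geo {k : ℝ → ℝ} (hk : Continuous k) (p v : E3) :
    ∫ t in (0 : ℝ)..π, zonal k (geo p v t)
      = 2 * ∫ y in (0 : ℝ)..(v 2), k (1 - p 2 ^ 2 - v 2 ^ 2 + y ^ 2) := by
  have hg : Continuous fun z : ℝ => k (1 - p 2 ^ 2 - v 2 ^ 2 + z) := hk.comp (by fun_prop)
  rw [← integral_neg_self_comp_sq hg]
  have h := intervalIntegral.integral_comp_mul_deriv (a := 0) (b := π)
    (f := fun t => v 2 * cos t - p 2 * sin t) (f' := fun t => -(v 2 * sin t + p 2 * cos t))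
    (g := fun y : ℝ => k (1 - p 2 ^ 2 - v 2 ^ 2 + y ^ 2))
    (fun t _ => (((hasDerivAt_cos t).const_mul (v 2)).sub
      ((hasDerivAt_sin t).const_mul (p 2))).congr_deriv (by ring)) (by fun_prop)
      (hg.comp (by fun_prop : Continuous fun y : ℝ => y ^ 2))
  simp only [cos_pi, sin_pi, cos_zero, sin_zero, mul_zero, mul_one, sub_zero, mul_neg_one] at h
  rw [intervalIntegral.integral_symm (v 2), ← h, ← intervalIntegral.integral_neg]
  refine intervalIntegral.integral_congr fun t _ => ?_
  have hs : (geo p v t) 2 = cos t * p 2 + sin t * v 2 := by simp [geo]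
  have harg : 1 - (cos t * p 2 + sin t * v 2) ^ 2
      = 1 - p 2 ^ 2 - v 2 ^ 2 + (v 2 * cos t - p 2 * sin t) ^ 2 := by
    linear_combination (-p 2 ^ 2 - v 2 ^ 2) * (sin_sq_add_cos_sq t)
  simp only [zonal, hs, harg, Function.comp]
  ring

lemma neg_one_zpow_mul_integral_profile_pos (n : ℤ) {W b : ℝ}
    (hW1 : exp (n * π - 2 * bumpWidth) ≤ W) (hW2 : W ≤ exp (n * π - bumpWidth)) (hb : 0 ≤ b)
    (hD1 : exp (n * π + π / 2) ≤ W + b ^ 2) (hD2 : W + b ^ 2 ≤ exp (n * π + 5 * π / 2)) :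
    0 < (-1) ^ n * ∫ y in (0 : ℝ)..b, profile (W + y ^ 2) := by
  set q := exp (n * π / 2) with hq
  have hq0 : 0 < q := exp_pos _
  have hq2 : q ^ 2 = exp (n * π) := by rw [hq, ← exp_nat_mul]; congr 1; push_cast; ring
  obtain ⟨c, rfl⟩ : ∃ c, b = q * c := ⟨b / q, by field_simp⟩
  obtain ⟨V, rfl⟩ : ∃ V, W = q ^ 2 * V := ⟨W / q ^ 2, by field_simp⟩
  have hsum : q ^ 2 * V + (q * c) ^ 2 = q ^ 2 * (V + c ^ 2) := by ring
  have hq20 : 0 < q ^ 2 := by positivity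
  rw [hsum] at hD1 hD2
  rw [sub_eq_add_neg, exp_add, ← hq2] at hW1 hW2
  rw [exp_add, ← hq2] at hD1 hD2
  rw [mul_le_mul_iff_right₀ hq20] at hW1 hW2 hD1 hD2
  have hc : 0 ≤ c := nonneg_of_mul_nonneg_right hb hq0
  rw [← neg_mul] at hW1
  have hpos := integral_profile_add_sq_pos hW1 hW2 hc hD1 hD2
  have hV : 0 < V := (exp_pos _).trans_le hW1
  have hscale : ∀ y : ℝ, profile (q ^ 2 * V + (q * y) ^ 2)
      = (-1) ^ n * q ^ 2 * profile (V + y ^ 2) := by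
    intro y
    rw [show q ^ 2 * V + (q * y) ^ 2 = exp (n * π) * (V + y ^ 2) by rw [← hq2]; ring,
      profile_exp_int_mul_pi_mul n (by positivity), hq2]
  have h := intervalIntegral.mul_integral_comp_mul_left (a := 0) (b := c)
    (f := fun y => profile (q ^ 2 * V + y ^ 2)) q
  rw [mul_zero] at h
  rw [← h]
  simp only [hscale, intervalIntegral.integral_const_mul]
  have hsq : ((-1 : ℝ) ^ n) * (-1) ^ n = 1 := by
    rw [← mul_zpow]; simp
  calc (0 : ℝ) < q * q ^ 2 * ∫ y in (0 : ℝ)..c, profile (V + y ^ 2) := by positivity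
    _ = ((-1) ^ n * (-1) ^ n) * (q * q ^ 2 * ∫ y in (0 : ℝ)..c, profile (V + y ^ 2)) := by
      rw [hsq, one_mul]
    _ = _ := by ring

/-- A lower bound for the length of the arcs of directions on which the half-circle integrals of
`zonal profile` have a constant sign. -/
def arcLength : ℝ := (exp (-bumpWidth / 2) - exp (-bumpWidth)) * exp (-(5 * π / 4))

lemma arcLength_pos : 0 < arcLength := by
  have : exp (-bumpWidth) < exp (-bumpWidth / 2) := exp_lt_exp.2 (by linarith [bumpWidth_pos])
  exact mul_pos (by linarith) (exp_pos _)

lemma exists_int_neg_one_zpow_eq {s : ℝ} (hs : s = 1 ∨ s = -1) (X : ℝ) :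
    ∃ n : ℤ, (-1 : ℝ) ^ n = s ∧ n * π + π / 2 ≤ X ∧ X ≤ n * π + 5 * π / 2 := by
  have key : ∀ e : ℤ, ∃ m : ℤ, ((2 * m + e : ℤ) : ℝ) * π + π / 2 ≤ X ∧
      X ≤ ((2 * m + e : ℤ) : ℝ) * π + 5 * π / 2 := by
    intro e
    refine ⟨⌊(X - e * π - π / 2) / (2 * π)⌋, ?_, ?_⟩
    · have := Int.floor_le ((X - e * π - π / 2) / (2 * π))
      rw [le_div_iff₀ (by positivity)] at this
      push_cast
      linarith
    · have := Int.lt_floor_add_one ((X - e * π - π / 2) / (2 * π))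
      rw [div_lt_iff₀ (by positivity)] at this
      push_cast
      linarith
  rcases hs with rfl | rfl
  · obtain ⟨m, hm⟩ := key 0
    exact ⟨_, Even.neg_one_zpow ⟨m, by ring⟩, hm⟩
  · obtain ⟨m, hm⟩ := key 1
    exact ⟨_, Odd.neg_one_zpow ⟨m, by ring⟩, hm⟩

lemma exists_arc_integral_profile_pos {D s : ℝ} (hD : 0 < D) (hs : s = 1 ∨ s = -1) :
    ∃ l U : ℝ, 0 < l ∧ U < π / 2 ∧ arcLength ≤ U - l ∧ ∀ ψ ∈ Icc l U,
      0 < s * ∫ y in (0 : ℝ)..(√D * cos ψ), profile (D - (√D * cos ψ) ^ 2 + y ^ 2) := by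
  obtain ⟨n, hn, hX1, hX2⟩ := exists_int_neg_one_zpow_eq hs (log D)
  have hδ0 := bumpWidth_pos
  have hDexp : D = exp (log D) := (exp_log hD).symm
  set X := log D
  set r := exp ((n * π - X) / 2) with hr
  have hr0 : 0 < r := exp_pos _
  have hr1 : r < 1 := by
    rw [hr, exp_lt_one_iff]; linarith [pi_pos]
  have hrl : exp (-(5 * π / 4)) ≤ r := exp_le_exp.2 (by linarith)
  have hDr : D * r ^ 2 = exp (n * π) := by
    rw [hDexp, hr, ← exp_nat_mul, ← exp_add]; congr 1; push_cast; ring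
  have hx0 : 0 < exp (-bumpWidth) * r := by positivity
  have hxy : exp (-bumpWidth) < exp (-bumpWidth / 2) := exp_lt_exp.2 (by linarith)
  have hy1 : exp (-bumpWidth / 2) * r < 1 := by
    have : exp (-bumpWidth / 2) ≤ 1 := exp_le_one_iff.2 (by linarith)
    nlinarith
  have hxy' : exp (-bumpWidth) * r < exp (-bumpWidth / 2) * r := by gcongr
  have hsl : sin (arcsin (exp (-bumpWidth) * r)) = exp (-bumpWidth) * r :=
    sin_arcsin (by linarith) (by linarith)
  have hsU : sin (arcsin (exp (-bumpWidth / 2) * r)) = exp (-bumpWidth / 2) * r :=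
    sin_arcsin (by linarith) (by linarith)
  have hlU : arcsin (exp (-bumpWidth) * r) ≤ arcsin (exp (-bumpWidth / 2) * r) :=
    monotone_arcsin hxy'.le
  have hl0 := arcsin_pos.2 hx0
  have hU := arcsin_lt_pi_div_two.2 hy1
  refine ⟨arcsin (exp (-bumpWidth) * r), arcsin (exp (-bumpWidth / 2) * r), hl0, hU, ?_, ?_⟩
  · have h1 := (le_abs_self _).trans (abs_sin_sub_sin_le (arcsin (exp (-bumpWidth / 2) * r))
      (arcsin (exp (-bumpWidth) * r)))
    rw [hsl, hsU, ← sub_mul, abs_of_nonneg (sub_nonneg.2 hlU)] at h1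
    refine le_trans ?_ h1
    exact mul_le_mul_of_nonneg_left hrl (by linarith)
  · intro ψ hψ
    have hs1 : exp (-bumpWidth) * r ≤ sin ψ := by
      rw [← hsl]; exact sin_le_sin_of_le_of_le_pi_div_two (by linarith) (by linarith [hψ.2]) hψ.1
    have hs2 : sin ψ ≤ exp (-bumpWidth / 2) * r := by
      rw [← hsU]
      exact sin_le_sin_of_le_of_le_pi_div_two (by linarith [hψ.1]) hU.le hψ.2
    have hcos : 0 ≤ cos ψ :=
      cos_nonneg_of_mem_Icc ⟨by linarith [hψ.1, pi_pos], by linarith [hψ.2]⟩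
    have hW : D - (√D * cos ψ) ^ 2 = D * sin ψ ^ 2 := by
      rw [mul_pow, sq_sqrt hD.le, sin_sq]; ring
    rw [← hn]
    refine neg_one_zpow_mul_integral_profile_pos n ?_ ?_ (by positivity) ?_ ?_
    · rw [hW]
      calc exp (n * π - 2 * bumpWidth) = D * (exp (-bumpWidth) * r) ^ 2 := by
            rw [mul_pow, mul_left_comm, hDr, ← exp_nat_mul, ← exp_add]
            congr 1; push_cast; ring
        _ ≤ D * sin ψ ^ 2 := by gcongr
    · rw [hW]
      calc D * sin ψ ^ 2 ≤ D * (exp (-bumpWidth / 2) * r) ^ 2 := by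
            have : 0 ≤ sin ψ := by linarith
            gcongr
        _ = exp (n * π - bumpWidth) := by
            rw [mul_pow, mul_left_comm, hDr, ← exp_nat_mul, ← exp_add]
            congr 1; push_cast; ring
    · rw [sub_add_cancel, hDexp]; exact exp_le_exp.2 hX1
    · rw [sub_add_cancel, hDexp]; exact exp_le_exp.2 hX2

lemma inner_eq_coord (x y : E3) : ⟪x, y⟫ = x 0 * y 0 + x 1 * y 1 + x 2 * y 2 := by
  simp [PiLp.inner_apply, Fin.sum_univ_three, mul_comm]

lemma norm_eq_one_iff_coord (x : E3) : ‖x‖ = 1 ↔ x 0 ^ 2 + x 1 ^ 2 + x 2 ^ 2 = 1 := by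
  rw [← pow_eq_one_iff_of_nonneg (norm_nonneg x) two_ne_zero, ← real_inner_self_eq_norm_sq,
    inner_eq_coord]
  simp only [sq]

/-- At every point of the sphere there is an orthonormal frame consisting of a direction pointing
towards the north pole and a horizontal direction. -/
lemma exists_frame {p : E3} (hp : ‖p‖ = 1) :
    ∃ w h : E3, UnitTangent p w ∧ UnitTangent p h ∧ ⟪w, h⟫ = 0 ∧
      w 2 = √(1 - p 2 ^ 2) ∧ h 2 = 0 := by
  rw [norm_eq_one_iff_coord] at hp
  simp only [UnitTangent, norm_eq_one_iff_coord, inner_eq_coord]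
  rcases eq_or_ne (1 - p 2 ^ 2) 0 with h0 | h0
  · have hp0 : p 0 = 0 := by nlinarith
    have hp1 : p 1 = 0 := by nlinarith
    refine ⟨!₂[1, 0, 0], !₂[0, 1, 0], ?_⟩
    simp [hp0, hp1, h0]
  · have hpos : 0 < 1 - p 2 ^ 2 := lt_of_le_of_ne (by nlinarith [sq_nonneg (p 0)]) h0.symm
    set d := √(1 - p 2 ^ 2) with hd
    have hd0 : d ≠ 0 := (sqrt_pos.2 hpos).ne'
    have hd2 : d ^ 2 = 1 - p 2 ^ 2 := sq_sqrt hpos.le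
    have hp' : p 0 ^ 2 + p 1 ^ 2 = d ^ 2 := by linarith
    refine ⟨!₂[-p 2 * p 0 / d, -p 2 * p 1 / d, d], !₂[-p 1 / d, p 0 / d, 0], ⟨?_, ?_⟩, ⟨?_, ?_⟩,
      ?_, ?_, ?_⟩ <;> simp <;> field_simp <;>
      first
      | ring1
      | linear_combination p 2 ^ 2 * hp' + d ^ 2 * hd2
      | linear_combination -p 2 * hp'
      | linear_combination hp'

lemma inner_ne_zero_of_frame {p u w h : E3} (hp : ‖p‖ = 1) (hu : UnitTangent p u)
    (hw : UnitTangent p w) (hh : UnitTangent p h) (hwh : ⟪w, h⟫ = 0) :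
    ⟪u, w⟫ ≠ 0 ∨ ⟪u, h⟫ ≠ 0 := by
  by_contra! hc
  have ho : Orthonormal ℝ ![u, p, w, h] := by
    rw [orthonormal_iff_ite]
    have := hu.2
    have := hw.2
    have := hh.2
    intro i j
    fin_cases i <;> fin_cases j <;>
      simp_all [UnitTangent, real_inner_comm]
  have := ho.linearIndependent.fintype_card_le_finrank
  simp at this

lemma unitTangent_cos_smul_add_sin_smul {p w h : E3} (hw : UnitTangent p w)
    (hh : UnitTangent p h) (hwh : ⟪w, h⟫ = 0) (ψ : ℝ) :
    UnitTangent p (cos ψ • w + sin ψ • h) := by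
  refine ⟨?_, ?_⟩
  · rw [← pow_eq_one_iff_of_nonneg (norm_nonneg _) two_ne_zero, norm_add_sq_real]
    simp [norm_smul, inner_smul_left, inner_smul_right, hw.1, hh.1, hwh]
  · simp [inner_add_right, inner_smul_right, hw.2, hh.2]

lemma UnitTangent.smul {p v : E3} (hv : UnitTangent p v) {s : ℝ} (hs : s = 1 ∨ s = -1) :
    UnitTangent p (s • v) := by
  rcases hs with rfl | rfl <;> simpa [UnitTangent] using hv

lemma exists_sign_mul_nonneg (x : ℝ) : ∃ s : ℝ, (s = 1 ∨ s = -1) ∧ 0 ≤ s * x := by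
  rcases le_total 0 x with h | h
  · exact ⟨1, Or.inl rfl, by linarith⟩
  · exact ⟨-1, Or.inr rfl, by linarith⟩

lemma integral_zero_sign_mul {g : ℝ → ℝ} {s : ℝ} (hs : s = 1 ∨ s = -1) (c : ℝ) :
    ∫ y in (0 : ℝ)..(s * c), g (y ^ 2) = s * ∫ y in (0 : ℝ)..c, g (y ^ 2) := by
  rcases hs with rfl | rfl
  · simp
  · have h := intervalIntegral.integral_comp_neg (a := 0) (b := c) fun y : ℝ => g (y ^ 2)
    simp only [even_two.neg_pow, neg_zero] at h
    rw [h, intervalIntegral.integral_symm]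
    simp

/-- In every open half-circle of directions there is an arc of length at least `arcLength` on
which the half-circle integrals of `zonal profile` are nonpositive, and even negative away from
the poles. -/
lemma exists_arc_integral_zonal_nonpos {p u : E3} (hp : ‖p‖ = 1) (hu : UnitTangent p u) :
    ∃ (w h : E3) (l U : ℝ), UnitTangent p w ∧ UnitTangent p h ∧ ⟪w, h⟫ = 0 ∧
      0 < l ∧ U < π / 2 ∧ arcLength ≤ U - l ∧ ∀ ψ ∈ Icc l U,
        0 < ⟪u, cos ψ • w + sin ψ • h⟫ ∧
        (∫ t in (0 : ℝ)..π, zonal profile (geo p (cos ψ • w + sin ψ • h) t)) ≤ 0 ∧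
        (p 2 ^ 2 < 1 →
          (∫ t in (0 : ℝ)..π, zonal profile (geo p (cos ψ • w + sin ψ • h) t)) < 0) := by
  obtain ⟨w, h, hw, hh, hwh, hw2, hh2⟩ := exists_frame hp
  obtain ⟨s, hs, hsw⟩ := exists_sign_mul_nonneg ⟪u, w⟫
  obtain ⟨s', hs', hsh⟩ := exists_sign_mul_nonneg ⟪u, h⟫
  have hne := inner_ne_zero_of_frame hp hu hw hh hwh
  have hs0 : s ≠ 0 := by rcases hs with rfl | rfl <;> norm_num
  have hs0' : s' ≠ 0 := by rcases hs' with rfl | rfl <;> norm_num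
  have hneg : -s = 1 ∨ -s = -1 := by rcases hs with rfl | rfl <;> simp
  have hp2 : 0 ≤ 1 - p 2 ^ 2 := by
    rw [norm_eq_one_iff_coord] at hp
    nlinarith [sq_nonneg (p 0), sq_nonneg (p 1)]
  have hinner : ∀ ψ, 0 < ψ → ψ < π / 2 → 0 < ⟪u, cos ψ • (s • w) + sin ψ • (s' • h)⟫ := by
    intro ψ h1 h2
    have hc : 0 < cos ψ := cos_pos_of_mem_Ioo ⟨by linarith, h2⟩
    have hsin : 0 < sin ψ := sin_pos_of_pos_of_lt_pi h1 (by linarith)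
    simp only [inner_add_right, inner_smul_right]
    rcases hne with hne | hne
    · have : 0 < s * ⟪u, w⟫ := lt_of_le_of_ne hsw (mul_ne_zero hs0 hne).symm
      positivity
    · have : 0 < s' * ⟪u, h⟫ := lt_of_le_of_ne hsh (mul_ne_zero hs0' hne).symm
      positivity
  have hF : ∀ ψ, ∫ t in (0 : ℝ)..π, zonal profile (geo p (cos ψ • (s • w) + sin ψ • (s' • h)) t)
      = 2 * (s * ∫ y in (0 : ℝ)..(√(1 - p 2 ^ 2) * cos ψ),
        profile (1 - p 2 ^ 2 - (√(1 - p 2 ^ 2) * cos ψ) ^ 2 + y ^ 2)) := by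
    intro ψ
    have hv : (cos ψ • (s • w) + sin ψ • (s' • h)) 2 = s * (√(1 - p 2 ^ 2) * cos ψ) := by
      simp [hw2, hh2]; ring
    have hs2 : s ^ 2 = 1 := by rcases hs with rfl | rfl <;> norm_num
    rw [integral_zonal_geo continuous_profile, hv, mul_pow s, hs2, one_mul,
      integral_zero_sign_mul
        (g := fun z => profile (1 - p 2 ^ 2 - (√(1 - p 2 ^ 2) * cos ψ) ^ 2 + z)) hs]
  have hwh' : ⟪s • w, s' • h⟫ = 0 := by simp [inner_smul_left, inner_smul_right, hwh]
  rcases hp2.eq_or_lt with hD | hD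
  · obtain ⟨l, U, hl, hU, hlU, -⟩ := exists_arc_integral_profile_pos one_pos hneg
    refine ⟨s • w, s' • h, l, U, hw.smul hs, hh.smul hs', hwh', hl, hU, hlU, fun ψ hψ => ?_⟩
    refine ⟨hinner ψ (by linarith [hψ.1]) (by linarith [hψ.2]), ?_, fun h => by linarith⟩
    rw [hF, ← hD]
    simp
  · obtain ⟨l, U, hl, hU, hlU, hposInt⟩ := exists_arc_integral_profile_pos hD hneg
    refine ⟨s • w, s' • h, l, U, hw.smul hs, hh.smul hs', hwh', hl, hU, hlU, fun ψ hψ => ?_⟩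
    have := hposInt ψ hψ
    rw [hF]
    exact ⟨hinner ψ (by linarith [hψ.1]) (by linarith [hψ.2]), by linarith, fun _ => by linarith⟩

/-- The odd (for odd `M`) harmonic polynomial `x ↦ Re ((x₁ + i x₂) ^ M)` on `ℝ³`. -/
def planar (M : ℕ) (x : E3) : ℝ := (((x 0 : ℂ) + x 1 * Complex.I) ^ M).re

lemma contDiff_planar (M : ℕ) : ContDiff ℝ (⊤ : ℕ∞) (planar M) := by
  have h (i : Fin 3) : ContDiff ℝ (⊤ : ℕ∞) fun x : E3 => ((x i : ℝ) : ℂ) :=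
    Complex.ofRealCLM.contDiff.comp (EuclideanSpace.proj (𝕜 := ℝ) i).contDiff
  exact Complex.reCLM.contDiff.comp (((h 0).add ((h 1).mul contDiff_const)).pow M)

lemma planar_neg {M : ℕ} (hM : Odd M) (x : E3) : planar M (-x) = -planar M x := by
  have : (((-x) 0 : ℝ) : ℂ) + ((-x) 1 : ℝ) * Complex.I = -((x 0 : ℂ) + x 1 * Complex.I) := by
    simp; ring
  rw [planar, planar, this, hM.neg_pow, Complex.neg_re]

lemma continuous_integral_geo {f : E3 → ℝ} (hf : Continuous f) :
    Continuous fun z : E3 × E3 => ∫ t in (0 : ℝ)..π, f (geo z.1 z.2 t) := by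
  refine intervalIntegral.continuous_parametric_intervalIntegral_of_continuous' ?_ 0 π
  unfold geo Function.uncurry
  fun_prop

lemma continuous_integral_geo_comp {X : Type*} [TopologicalSpace X] {f : E3 → ℝ}
    (hf : Continuous f) {P V : X → E3} (hP : Continuous P) (hV : Continuous V) :
    Continuous fun x => ∫ t in (0 : ℝ)..π, f (geo (P x) (V x) t) :=
  (continuous_integral_geo hf).comp (hP.prodMk hV)

lemma integral_planar_geo_of_pole {p v : E3} (h0 : p 0 = 0) (h1 : p 1 = 0) (M : ℕ) :
    ∫ t in (0 : ℝ)..π, planar M (geo p v t) = (∫ t in (0 : ℝ)..π, sin t ^ M) * planar M v := by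
  rw [← intervalIntegral.integral_mul_const]
  refine intervalIntegral.integral_congr fun t _ => ?_
  have : (((geo p v t) 0 : ℝ) : ℂ) + ((geo p v t) 1 : ℝ) * Complex.I
      = (sin t : ℝ) * ((v 0 : ℂ) + v 1 * Complex.I) := by
    simp [geo, h0, h1]; ring
  simp only [planar]
  rw [this, mul_pow, ← Complex.ofReal_pow, Complex.re_ofReal_mul]

lemma exists_re_mul_exp_neg {ζ : ℂ} (hζ : ζ ≠ 0) {s : ℝ} (hs : s = 1 ∨ s = -1) :
    ∃ j : ℝ, 1 ≤ j ∧ j ≤ 4 ∧ (ζ * Complex.exp (s * (j * (π / 2)) * Complex.I)).re < 0 := by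
  have hexp : ∀ x : ℝ, (ζ * Complex.exp (s * x * Complex.I)).re
      = ζ.re * cos x - s * ζ.im * sin x := by
    intro x
    rw [← Complex.ofReal_mul, Complex.exp_mul_I, ← Complex.ofReal_cos, ← Complex.ofReal_sin]
    rcases hs with rfl | rfl <;> simp [-Complex.ofReal_cos, -Complex.ofReal_sin]
  have hexp' : ∀ j : ℝ, (ζ * Complex.exp (s * (j * (π / 2)) * Complex.I)).re
      = ζ.re * cos (j * (π / 2)) - s * ζ.im * sin (j * (π / 2)) := by
    intro j
    rw [← hexp]; push_cast; rfl
  simp only [hexp']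
  have h3 : (3 : ℝ) * (π / 2) = π / 2 + π := by ring
  have h4 : (4 : ℝ) * (π / 2) = 2 * π := by ring
  have h2 : (2 : ℝ) * (π / 2) = π := by ring
  rcases lt_trichotomy ζ.re 0 with h | h | h
  · exact ⟨4, by norm_num, le_rfl, by simpa [h4] using h⟩
  · have him : s * ζ.im ≠ 0 := by
      refine mul_ne_zero (by rcases hs with rfl | rfl <;> norm_num) fun h' => hζ ?_
      exact Complex.ext h h'
    rcases him.lt_or_gt with h' | h'
    · exact ⟨3, by norm_num, by norm_num, by
        rw [h3, cos_add_pi, sin_add_pi, cos_pi_div_two, sin_pi_div_two]; linarith⟩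
    · exact ⟨1, le_rfl, by norm_num, by simpa [h] using h'⟩
  · exact ⟨2, by norm_num, by norm_num, by simpa [h2] using h⟩

lemma exists_planar_neg {M : ℕ} (hM : 0 < M) {w h : E3} (hw : ‖w‖ = 1) (hh : ‖h‖ = 1)
    (hwh : ⟪w, h⟫ = 0) (hw2 : w 2 = 0) (hh2 : h 2 = 0) (l : ℝ) :
    ∃ ψ : ℝ, l < ψ ∧ ψ ≤ l + 2 * π / M ∧ planar M (cos ψ • w + sin ψ • h) < 0 := by
  rw [norm_eq_one_iff_coord, hw2] at hw
  rw [norm_eq_one_iff_coord, hh2] at hh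
  rw [inner_eq_coord, hw2] at hwh
  obtain ⟨s, hs⟩ : ∃ s, s = w 0 * h 1 - w 1 * h 0 := ⟨_, rfl⟩
  have hs2 : s = 1 ∨ s = -1 := by
    rw [← sq_eq_one_iff, hs]
    linear_combination (h 0 ^ 2 + h 1 ^ 2) * hw + hh - (w 0 * h 0 + w 1 * h 1) * hwh
  have e0 : h 0 = -s * w 1 := by
    rw [hs]; linear_combination w 0 * hwh - h 0 * hw
  have e1 : h 1 = s * w 0 := by
    rw [hs]; linear_combination w 1 * hwh - h 1 * hw
  set Z : ℂ := w 0 + w 1 * Complex.I with hZ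
  have hZ0 : Z ≠ 0 := by
    intro h0
    have hr := congrArg Complex.re h0
    have hi := congrArg Complex.im h0
    simp [hZ] at hr hi
    simp [hr, hi] at hw
  have hplanar : ∀ ψ : ℝ, planar M (cos ψ • w + sin ψ • h)
      = (Z ^ M * Complex.exp (s * (M * ψ) * Complex.I)).re := by
    intro ψ
    have hz : (((cos ψ • w + sin ψ • h) 0 : ℝ) : ℂ) + ((cos ψ • w + sin ψ • h) 1 : ℝ) * Complex.I
        = Z * Complex.exp (s * ψ * Complex.I) := by
      rw [← Complex.ofReal_mul, Complex.exp_mul_I, ← Complex.ofReal_cos, ← Complex.ofReal_sin]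
      apply Complex.ext
      · rcases hs2 with h' | h' <;> simp [e0, e1, hZ, h'] <;> ring
      · rcases hs2 with h' | h' <;> simp [e0, e1, hZ, h'] <;> ring
    rw [planar, hz, mul_pow, ← Complex.exp_nat_mul]
    congr 3
    ring
  have hMr : (0 : ℝ) < M := by exact_mod_cast hM
  obtain ⟨j, hj1, hj4, hj⟩ := exists_re_mul_exp_neg
    (mul_ne_zero (pow_ne_zero M hZ0) (Complex.exp_ne_zero (s * (M * l) * Complex.I))) hs2
  refine ⟨l + j * (π / 2) / M, ?_, ?_, ?_⟩
  · have : 0 < j * (π / 2) / M := by positivity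
    linarith
  · have : j * (π / 2) ≤ 2 * π := by nlinarith [pi_pos]
    linarith [div_le_div_of_nonneg_right this hMr.le]
  · rw [hplanar]
    rw [mul_assoc, ← Complex.exp_add] at hj
    convert hj using 4
    push_cast
    have : (M : ℂ) ≠ 0 := by exact_mod_cast hM.ne'
    field_simp

/-- Near the poles, the half-circle integrals of `planar M` take a negative value on every arc of
directions that is not too short. -/
lemma eventually_exists_integral_planar_neg {M : ℕ} (hM : 0 < M) {η : ℝ} (hη : 2 * π / M < η)
    {p₀ : E3} (hp : ‖p₀‖ = 1) (h0 : p₀ 0 = 0) (h1 : p₀ 1 = 0) :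
    ∀ᶠ p in 𝓝 p₀, ∀ w h : E3, ∀ l : ℝ, UnitTangent p w → UnitTangent p h → ⟪w, h⟫ = 0 →
      l ∈ Icc 0 (π / 2) → ∃ ψ ∈ Icc l (l + η),
        (∫ t in (0 : ℝ)..π, planar M (geo p (cos ψ • w + sin ψ • h) t)) < 0 := by
  have hK : IsCompact (Metric.sphere (0 : E3) 1 ×ˢ Metric.sphere (0 : E3) 1 ×ˢ Icc 0 (π / 2)) :=
    (isCompact_sphere _ _).prod ((isCompact_sphere _ _).prod isCompact_Icc)
  have key := hK.eventually_forall_of_forall_eventually (x₀ := p₀)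
    (P := fun p y => ⟪p, y.1⟫ = 0 → ⟪p, y.2.1⟫ = 0 → ⟪y.1, y.2.1⟫ = 0 →
      ∃ ψ ∈ Icc y.2.2 (y.2.2 + η),
        (∫ t in (0 : ℝ)..π, planar M (geo p (cos ψ • y.1 + sin ψ • y.2.1) t)) < 0) ?_
  · filter_upwards [key] with p hp w h l hw hh hwh hl
    exact hp (w, h, l) ⟨by simpa using hw.1, by simpa using hh.1, hl⟩ hw.2 hh.2 hwh
  rintro ⟨w, h, l⟩ ⟨hw, hh, hl⟩
  simp only [mem_sphere_iff_norm, sub_zero] at hw hh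
  by_cases hc : ⟪p₀, w⟫ = 0 ∧ ⟪p₀, h⟫ = 0 ∧ ⟪w, h⟫ = 0
  · obtain ⟨hpw, hph, hwh⟩ := hc
    have hp2 : p₀ 2 ≠ 0 := by
      intro h2
      rw [norm_eq_one_iff_coord, h0, h1, h2] at hp
      norm_num at hp
    rw [inner_eq_coord, h0, h1] at hpw hph
    have hw2 : w 2 = 0 := by simpa [hp2] using hpw
    have hh2 : h 2 = 0 := by simpa [hp2] using hph
    obtain ⟨ψ, hψ1, hψ2, hψ⟩ := exists_planar_neg hM hw hh hwh hw2 hh2 l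
    have hneg : (∫ t in (0 : ℝ)..π, planar M (geo p₀ (cos ψ • w + sin ψ • h) t)) < 0 := by
      rw [integral_planar_geo_of_pole h0 h1]
      exact mul_neg_of_pos_of_neg (integral_sin_pow_pos M) hψ
    have hcont : Continuous fun z : E3 × E3 × E3 × ℝ =>
        ∫ t in (0 : ℝ)..π, planar M (geo z.1 (cos ψ • z.2.1 + sin ψ • z.2.2.1) t) :=
      continuous_integral_geo_comp (contDiff_planar M).continuous continuous_fst
        (by fun_prop : Continuous fun z : E3 × E3 × E3 × ℝ => cos ψ • z.2.1 + sin ψ • z.2.2.1)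
    have hl' : Continuous fun z : E3 × E3 × E3 × ℝ => z.2.2.2 := by fun_prop
    filter_upwards [hcont.continuousAt.eventually_lt_const hneg,
      hl'.continuousAt.eventually_lt_const hψ1,
      hl'.continuousAt.eventually_const_lt (show ψ - η < l by linarith)] with z hz1 hz2 hz3 _ _ _
    exact ⟨ψ, ⟨hz2.le, by linarith⟩, hz1⟩
  · have hclosed : IsClosed {z : E3 × E3 × E3 × ℝ |
        ⟪z.1, z.2.1⟫ = 0 ∧ ⟪z.1, z.2.2.1⟫ = 0 ∧ ⟪z.2.1, z.2.2.1⟫ = 0} :=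
      (isClosed_eq (by fun_prop) (by fun_prop)).inter
        ((isClosed_eq (by fun_prop) (by fun_prop)).inter
          (isClosed_eq (by fun_prop) (by fun_prop)))
    filter_upwards [hclosed.isOpen_compl.mem_nhds hc] with z hz h1 h2 h3
    exact absurd ⟨h1, h2, h3⟩ hz

/-- The existence of a direction with a negative half-circle integral is an open condition. -/
lemma eventually_exists_unitTangent {Φ : ℝ → E3 → E3 → ℝ}
    (hΦ : Continuous fun z : ℝ × E3 × E3 => Φ z.1 z.2.1 z.2.2) {a : ℝ} {p₀ u₀ v₀ : E3}
    (hv : UnitTangent p₀ v₀) (huv : 0 < ⟪u₀, v₀⟫) (hneg : Φ a p₀ v₀ < 0) :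
    ∀ᶠ z : ℝ × E3 × E3 in 𝓝 (a, p₀, u₀), ‖z.2.1‖ = 1 →
      ∃ v, UnitTangent z.2.1 v ∧ 0 < ⟪z.2.2, v⟫ ∧ Φ z.1 z.2.1 v < 0 := by
  set V : ℝ × E3 × E3 → E3 := fun z => v₀ - ⟪z.2.1, v₀⟫ • z.2.1 with hV
  have hVc : Continuous V := by fun_prop
  have hV0 : V (a, p₀, u₀) = v₀ := by simp [hV, hv.2]
  have hN : ContinuousAt (fun z => ‖V z‖⁻¹ • V z) (a, p₀, u₀) := by
    refine (hVc.norm.continuousAt.inv₀ ?_).smul hVc.continuousAt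
    rw [hV0, hv.1]; norm_num
  have hN0 : ‖V (a, p₀, u₀)‖⁻¹ • V (a, p₀, u₀) = v₀ := by simp [hV0, hv.1]
  have c1 : ContinuousAt (fun z : ℝ × E3 × E3 => ⟪z.2.2, ‖V z‖⁻¹ • V z⟫) (a, p₀, u₀) :=
    ContinuousAt.inner (continuous_snd.comp continuous_snd).continuousAt hN
  have c2 : ContinuousAt (fun z : ℝ × E3 × E3 => Φ z.1 z.2.1 (‖V z‖⁻¹ • V z)) (a, p₀, u₀) :=
    ContinuousAt.comp (f := fun z : ℝ × E3 × E3 => (z.1, z.2.1, ‖V z‖⁻¹ • V z))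
      hΦ.continuousAt (continuousAt_fst.prodMk (ContinuousAt.prodMk (by fun_prop) hN))
  have i1 : 0 < ⟪u₀, ‖V (a, p₀, u₀)‖⁻¹ • V (a, p₀, u₀)⟫ := by rwa [hN0]
  have i2 : Φ a p₀ (‖V (a, p₀, u₀)‖⁻¹ • V (a, p₀, u₀)) < 0 := by rwa [hN0]
  filter_upwards [c1.tendsto.eventually_const_lt i1, c2.tendsto.eventually_lt_const i2,
    hVc.norm.continuousAt.eventually_const_lt
      (show 0 < ‖V (a, p₀, u₀)‖ by rw [hV0, hv.1]; norm_num)] with z h1 h2 h3 hz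
  refine ⟨_, ⟨?_, ?_⟩, h1, h2⟩
  · rw [norm_smul, norm_inv, norm_norm, inv_mul_cancel₀ h3.ne']
  · simp [hV, inner_smul_right, inner_sub_right, hz]

lemma isCompact_setOf_unitTangent :
    IsCompact {z : E3 × E3 | ‖z.1‖ = 1 ∧ UnitTangent z.1 z.2} := by
  refine ((isCompact_sphere (0 : E3) 1).prod (isCompact_sphere (0 : E3) 1)).of_isClosed_subset
    ?_ fun z hz => ⟨by simpa using hz.1, by simpa using hz.2.1⟩
  exact (isClosed_eq (by fun_prop) (by fun_prop)).inter
    ((isClosed_eq (by fun_prop) (by fun_prop)).inter (isClosed_eq (by fun_prop) (by fun_prop)))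

/-- A continuous L-good function is L-good with a uniform margin. -/
lemma LGood.exists_margin {f : E3 → ℝ} (hf : LGood f) (hc : Continuous f) :
    ∃ ρ > 0, ∀ p ∈ sphere2, ∀ u, UnitTangent p u →
      ∃ v, UnitTangent p v ∧ 0 < ⟪u, v⟫ ∧ (∫ t in (0 : ℝ)..π, f (geo p v t)) + ρ < 0 := by
  have key := isCompact_setOf_unitTangent.eventually_forall_of_forall_eventually (x₀ := (0 : ℝ))
    (P := fun ρ z => ‖z.1‖ = 1 → ∃ v, UnitTangent z.1 v ∧ 0 < ⟪z.2, v⟫ ∧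
      (∫ t in (0 : ℝ)..π, f (geo z.1 v t)) + ρ < 0) ?_
  · obtain ⟨ρ, hρ0, hρ⟩ := ((Filter.Eventually.filter_mono nhdsWithin_le_nhds key).and
      (self_mem_nhdsWithin (s := Ioi (0 : ℝ)))).exists
    exact ⟨ρ, hρ, fun p hp u hu => hρ0 (p, u) ⟨hp, hu⟩ hp⟩
  · rintro ⟨p, u⟩ ⟨hp, hu⟩
    obtain ⟨v, hv, huv, hneg⟩ := hf p hp u hu
    refine eventually_exists_unitTangent (a := 0)
      (Φ := fun ρ p v => (∫ t in (0 : ℝ)..π, f (geo p v t)) + ρ) ?_ hv huv (by simpa using hneg)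
    exact ((continuous_integral_geo hc).comp continuous_snd).add continuous_fst

lemma continuous_zonal {k : ℝ → ℝ} (hk : Continuous k) : Continuous (zonal k) := by
  unfold zonal
  fun_prop

lemma continuous_geo (p v : E3) : Continuous (geo p v) := by
  unfold geo
  fun_prop

lemma integral_zonal_add_mul_planar (k : ℝ → ℝ) (hk : Continuous k) (M : ℕ) (ε : ℝ) (p v : E3) :
    ∫ t in (0 : ℝ)..π, (zonal k (geo p v t) + ε * planar M (geo p v t))
      = (∫ t in (0 : ℝ)..π, zonal k (geo p v t))
        + ε * ∫ t in (0 : ℝ)..π, planar M (geo p v t) := by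
  have h1 := ((continuous_zonal hk).comp (continuous_geo p v)).intervalIntegrable
    (μ := MeasureTheory.volume) 0 π
  have h2 := (((contDiff_planar M).continuous.comp (continuous_geo p v)).const_mul
    ε).intervalIntegrable (μ := MeasureTheory.volume) 0 π
  rw [← intervalIntegral.integral_const_mul]
  exact intervalIntegral.integral_add h1 h2

lemma exists_lgood_zonal_add_mul_planar {M : ℕ} (hM : 0 < M) (hMη : 2 * π / M < arcLength) :
    ∃ ε : ℝ, LGood fun x => zonal profile x + ε * planar M x := by
  have hzc := continuous_zonal continuous_profile
  have hpc := (contDiff_planar M).continuous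
  have key := isCompact_setOf_unitTangent.eventually_forall_of_forall_eventually (x₀ := (0 : ℝ))
    (P := fun ε z => 0 < ε → ‖z.1‖ = 1 → UnitTangent z.1 z.2 →
      ∃ v, UnitTangent z.1 v ∧ 0 < ⟪z.2, v⟫ ∧
        (∫ t in (0 : ℝ)..π, (zonal profile (geo z.1 v t) + ε * planar M (geo z.1 v t))) < 0) ?_
  · obtain ⟨ε, hε0, hε⟩ := ((Filter.Eventually.filter_mono nhdsWithin_le_nhds key).and
      (self_mem_nhdsWithin (s := Ioi (0 : ℝ)))).exists
    exact ⟨ε, fun p hp u hu => hε0 (p, u) ⟨hp, hu⟩ hε hp hu⟩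
  simp only [integral_zonal_add_mul_planar _ continuous_profile]
  rintro ⟨p₀, u₀⟩ ⟨hp₀, hu₀⟩
  change ‖p₀‖ = 1 at hp₀
  have hp' := (norm_eq_one_iff_coord p₀).1 hp₀
  rcases lt_or_ge (p₀ 2 ^ 2) 1 with h | h
  · obtain ⟨w, h', l, U, hw, hh, hwh, -, -, hlU, harc⟩ := exists_arc_integral_zonal_nonpos hp₀ hu₀
    obtain ⟨hi, -, hn⟩ := harc l ⟨le_rfl, by linarith [arcLength_pos]⟩
    have hev := eventually_exists_unitTangent (a := 0)
      (Φ := fun ε p v => (∫ t in (0 : ℝ)..π, zonal profile (geo p v t))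
        + ε * ∫ t in (0 : ℝ)..π, planar M (geo p v t))
      (((continuous_integral_geo hzc).comp continuous_snd).add
        (continuous_fst.mul ((continuous_integral_geo hpc).comp continuous_snd)))
      (unitTangent_cos_smul_add_sin_smul hw hh hwh l) hi (by simpa using hn h)
    filter_upwards [hev] with z hz _ hz1 _
    exact hz hz1
  · have h0 : p₀ 0 = 0 := by nlinarith [sq_nonneg (p₀ 0), sq_nonneg (p₀ 1)]
    have h1 : p₀ 1 = 0 := by nlinarith [sq_nonneg (p₀ 0), sq_nonneg (p₀ 1)]
    have hev := eventually_exists_integral_planar_neg hM hMη hp₀ h0 h1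
    have htend : Tendsto (fun z : ℝ × E3 × E3 => z.2.1) (𝓝 (0, p₀, u₀)) (𝓝 p₀) :=
      (by fun_prop : Continuous fun z : ℝ × E3 × E3 => z.2.1).tendsto' _ _ rfl
    filter_upwards [htend.eventually hev] with z hz hε hz1 hu
    obtain ⟨w, h', l, U, hw, hh, hwh, hl, hU, hlU, harc⟩ := exists_arc_integral_zonal_nonpos hz1 hu
    have hη := arcLength_pos
    obtain ⟨ψ, hψ, hneg⟩ := hz w h' l hw hh hwh ⟨hl.le, by linarith⟩
    obtain ⟨hi, hn, -⟩ := harc ψ ⟨hψ.1, by linarith [hψ.2]⟩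
    exact ⟨_, unitTangent_cos_smul_add_sin_smul hw hh hwh ψ, hi, by
      linarith [mul_neg_of_pos_of_neg hε hneg]⟩

lemma norm_geo {p v : E3} (hp : ‖p‖ = 1) (hv : UnitTangent p v) (t : ℝ) : ‖geo p v t‖ = 1 := by
  rw [geo, ← pow_eq_one_iff_of_nonneg (norm_nonneg _) two_ne_zero, norm_add_sq_real]
  simp [norm_smul, inner_smul_left, inner_smul_right, hp, hv.1, hv.2]

/-- A continuous function that is uniformly close on the sphere to an L-good one is L-good. -/
lemma LGood.of_uniformly_close {f : E3 → ℝ} (hf : LGood f) (hc : Continuous f) :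
    ∃ ρ > 0, ∀ g : E3 → ℝ, Continuous g → (∀ x ∈ sphere2, g x - f x ≤ ρ) → LGood g := by
  obtain ⟨ρ, hρ, h⟩ := hf.exists_margin hc
  refine ⟨ρ / π, by positivity, fun g hg hgf p hp u hu => ?_⟩
  obtain ⟨v, hv, huv, hneg⟩ := h p hp u hu
  refine ⟨v, hv, huv, lt_of_le_of_lt ?_ hneg⟩
  have h1 : IntervalIntegrable (fun t => f (geo p v t)) MeasureTheory.volume 0 π :=
    (hc.comp (continuous_geo p v)).intervalIntegrable 0 π
  have h2 : IntervalIntegrable (fun t => g (geo p v t)) MeasureTheory.volume 0 π :=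
    (hg.comp (continuous_geo p v)).intervalIntegrable 0 π
  have h3 : ∫ t in (0 : ℝ)..π, g (geo p v t) ≤ ∫ t in (0 : ℝ)..π, (f (geo p v t) + ρ / π) := by
    refine intervalIntegral.integral_mono_on pi_pos.le h2 (h1.add (by simp)) fun t _ => ?_
    have := hgf (geo p v t) (norm_geo hp hv t)
    linarith
  rw [intervalIntegral.integral_add h1 (by simp)] at h3
  have h4 : π * (ρ / π) = ρ := by field_simp
  simpa [h4] using h3

/-- There exists a smooth odd L-good function on the sphere (given as the
restriction to S² of a C^∞ function on ℝ³). -/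
theorem exists_smooth_odd_lgood_function :
    ∃ f : E3 → ℝ, ContDiff ℝ (⊤ : ℕ∞) f ∧ (∀ x ∈ sphere2, f (-x) = -f x) ∧ LGood f := by
  obtain ⟨n, hn⟩ := exists_nat_gt (2 * π / arcLength)
  have hMη : 2 * π / ((2 * n + 1 : ℕ) : ℝ) < arcLength := by
    rw [div_lt_iff₀ arcLength_pos] at hn
    rw [div_lt_iff₀ (by positivity)]
    push_cast
    have : 0 ≤ (n : ℝ) * arcLength := mul_nonneg n.cast_nonneg arcLength_pos.le
    linarith [arcLength_pos]
  obtain ⟨ε, hgood⟩ := exists_lgood_zonal_add_mul_planar (M := 2 * n + 1) (by lia) hMη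
  have hpc := (contDiff_planar (2 * n + 1)).continuous
  obtain ⟨ρ, hρ, hclose⟩ := hgood.of_uniformly_close
    ((continuous_zonal continuous_profile).add (hpc.const_mul ε))
  obtain ⟨P, hP⟩ := exists_polynomial_near_of_continuousOn 0 1 profile
    continuous_profile.continuousOn ρ hρ
  have hcd : ContDiff ℝ (⊤ : ℕ∞) fun x : E3 => x 2 :=
    (EuclideanSpace.proj (𝕜 := ℝ) (2 : Fin 3)).contDiff
  have hPcd : ContDiff ℝ (⊤ : ℕ∞) fun y => P.eval y := by simpa using P.contDiff_aeval (𝕜 := ℝ) _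
  have hzcd : ContDiff ℝ (⊤ : ℕ∞) (zonal fun y => P.eval y) :=
    hcd.mul (hPcd.comp (contDiff_const.sub (hcd.pow 2)))
  refine ⟨fun x => zonal (fun y => P.eval y) x + ε * planar (2 * n + 1) x,
    hzcd.add (contDiff_const.mul (contDiff_planar _)), fun x _ => ?_, ?_⟩
  · beta_reduce
    rw [planar_neg ⟨n, rfl⟩]
    simp only [zonal, PiLp.neg_apply, even_two.neg_pow]
    ring
  · refine hclose _ ((continuous_zonal P.continuous).add (hpc.const_mul ε)) fun x hx => ?_
    have hx' := (norm_eq_one_iff_coord x).1 hx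
    have hx1 : x 2 ^ 2 ≤ 1 := by nlinarith [sq_nonneg (x 0), sq_nonneg (x 1)]
    have habs : |x 2| ≤ 1 := (sq_le_one_iff_abs_le_one _).1 hx1
    have hy := hP (1 - x 2 ^ 2) ⟨by linarith, by nlinarith [sq_nonneg (x 2)]⟩
    calc _ = x 2 * (P.eval (1 - x 2 ^ 2) - profile (1 - x 2 ^ 2)) := by simp only [zonal]; ring
      _ ≤ |x 2| * |P.eval (1 - x 2 ^ 2) - profile (1 - x 2 ^ 2)| := by
        rw [← abs_mul]; exact le_abs_self _
      _ ≤ 1 * ρ := by gcongr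
      _ = ρ := one_mul ρ
end
end
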